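/- arXiv:2601.11994 — 6 statements merged into one kernel-verified Lean document; each statement's English description precedes it below -/
import Mathlib

section
/- Let L = {(g,0) : g ∈ SL(2,ℝ)} ⊂ G and let N⁺⋉ℝ² = {((1 x; 0 1), v) : x ∈ ℝ, v ∈ ℝ²} ⊂ G. Suppose (g_n, v_n) is a sequence in G and H is a closed subgroup of G such that (g_n,v_n) L (g_n,v_n)⁻¹ → H in the Chabauty sense. Then H is a conjugate of L in G (i.e. H = (g,v) L (g,v)⁻¹ for some (g,v) ∈ G) or H is a conjugate of N⁺⋉ℝ² in G. -/
open Matrix Filter Topology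

/-- `SL2` is the special linear group `SL(2,ℝ)`. -/
abbrev SL2 : Type := Matrix.SpecialLinearGroup (Fin 2) ℝ

/-- `M2` is the space of 2×2 real matrices. -/
abbrev M2 : Type := Matrix (Fin 2) (Fin 2) ℝ

noncomputable instance : TopologicalSpace SL2 :=
  TopologicalSpace.induced (fun g => (g : M2)) inferInstance

/-- Chabauty-sense convergence of a sequence of subsets of a topological space `X`:
(i) every point of the limit is a limit of a sequence of points of the `H n`;
(ii) every convergent sequence `x (k n) ∈ H (k n)` along a strictly increasing sequence
of indices has its limit in `L`. -/
def ChabautyTendsto {X : Type*} [TopologicalSpace X] (H : ℕ → Set X) (L : Set X) : Prop :=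
  (∀ h ∈ L, ∃ u : ℕ → X, (∀ n, u n ∈ H n) ∧ Filter.Tendsto u Filter.atTop (nhds h)) ∧
  (∀ k : ℕ → ℕ, StrictMono k → ∀ x : ℕ → X, (∀ n, x n ∈ H (k n)) →
    ∀ l : X, Filter.Tendsto x Filter.atTop (nhds l) → l ∈ L)

/-- Conjugate `x S x⁻¹` of a subset `S` of a group by a group element `x`. -/
def conjSet {X : Type*} [Group X] (x : X) (S : Set X) : Set X :=
  (fun s => x * s * x⁻¹) '' S

/-- The group `G = SL(2,ℝ) ⋉ ℝ²`: elements are pairs `(g, v)`. -/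
structure GSL : Type where
  g : SL2
  v : Fin 2 → ℝ

namespace GSL

noncomputable instance : TopologicalSpace GSL :=
  TopologicalSpace.induced (fun p => (p.g, p.v)) inferInstance

/-- Multiplication `(g,v)(g',v') = (gg', v + g·v')`. -/
noncomputable instance : Mul GSL :=
  ⟨fun p q => ⟨p.g * q.g, p.v + (p.g : M2) *ᵥ q.v⟩⟩

noncomputable instance : One GSL := ⟨⟨1, 0⟩⟩

noncomputable instance : Inv GSL :=
  ⟨fun p => ⟨p.g⁻¹, -((↑(p.g⁻¹) : M2) *ᵥ p.v)⟩⟩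

@[simp] lemma mul_def (p q : GSL) :
    p * q = ⟨p.g * q.g, p.v + (p.g : M2) *ᵥ q.v⟩ := rfl

@[simp] lemma one_def : (1 : GSL) = ⟨1, 0⟩ := rfl

@[simp] lemma inv_def (p : GSL) :
    p⁻¹ = ⟨p.g⁻¹, -((↑(p.g⁻¹) : M2) *ᵥ p.v)⟩ := rfl

noncomputable instance : Group GSL where
  mul_assoc a b c := by
    simp only [mul_def, GSL.mk.injEq]
    refine ⟨mul_assoc _ _ _, ?_⟩
    simp only [Matrix.SpecialLinearGroup.coe_mul, Matrix.mulVec_add, Matrix.mulVec_mulVec, add_assoc]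
  one_mul a := by
    simp only [one_def, mul_def, GSL.mk.injEq]
    simp
  mul_one a := by
    simp only [one_def, mul_def, GSL.mk.injEq]
    simp
  inv_mul_cancel a := by
    simp only [inv_def, mul_def, one_def, GSL.mk.injEq]
    exact ⟨inv_mul_cancel _, neg_add_cancel _⟩

end GSL

/-- The unipotent matrix `(1, s; 0, 1)` as an element of `SL(2,ℝ)`. -/
noncomputable def sMat (s : ℝ) : SL2 :=
  ⟨!![1, s; 0, 1], by simp [Matrix.det_fin_two_of]⟩

/-- The diagonal matrix `diag(a, 1/a)` as an element of `SL(2,ℝ)` (for `a ≠ 0`). -/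
noncomputable def aMat (a : ℝ) (ha : a ≠ 0) : SL2 :=
  ⟨!![a, 0; 0, a⁻¹], by simp [Matrix.det_fin_two_of, mul_inv_cancel₀ ha]⟩

/-- The Levi subgroup `L = {(g, 0) : g ∈ SL(2,ℝ)}` of `G`, as a set. -/
def LeviL : Set GSL := {p | p.v = 0}

/-- The subgroup `N⁺ ⋉ ℝ² = {((1,x;0,1), v) : x ∈ ℝ, v ∈ ℝ²}` of `G`, as a set. -/
def NplusR2 : Set GSL := {p | ∃ x : ℝ, (p.g : M2) = !![1, x; 0, 1]}

lemma mem_conj_levi (x p : GSL) :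
    p ∈ conjSet x LeviL ↔ p.v = x.v - (p.g : M2) *ᵥ x.v := by
  constructor
  · rintro ⟨s, hs, rfl⟩
    have hs : s.v = 0 := hs
    simp only [GSL.mul_def, GSL.inv_def, hs, Matrix.mulVec_neg, Matrix.mulVec_mulVec,
      Matrix.mulVec_zero, Matrix.SpecialLinearGroup.coe_mul]
    abel
  · intro h
    refine ⟨x⁻¹ * p * x, ?_, by group⟩
    change (x⁻¹ * p * x).v = 0
    simp only [GSL.mul_def, GSL.inv_def, h, Matrix.mulVec_sub, Matrix.mulVec_mulVec,
      Matrix.SpecialLinearGroup.coe_mul]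
    abel

lemma gsl_tendsto (u : ℕ → GSL) (p : GSL) :
    Tendsto u atTop (𝓝 p) ↔ Tendsto (fun n => ((u n).g : M2)) atTop (𝓝 (p.g : M2)) ∧
      Tendsto (fun n => (u n).v) atTop (𝓝 p.v) := by
  have h1 : IsInducing (fun p : GSL => (p.g, p.v)) := ⟨rfl⟩
  have h2 : IsInducing (fun g : SL2 => (g : M2)) := ⟨rfl⟩
  rw [h1.tendsto_nhds_iff, nhds_prod_eq, tendsto_prod_iff']
  simp only [Function.comp_def]
  rw [h2.tendsto_nhds_iff]
  rfl

lemma tendsto_mulVec {A : ℕ → M2} {B : M2} {w : ℕ → Fin 2 → ℝ} {v : Fin 2 → ℝ}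
    (hA : Tendsto A atTop (𝓝 B)) (hw : Tendsto w atTop (𝓝 v)) :
    Tendsto (fun n => A n *ᵥ w n) atTop (𝓝 (B *ᵥ v)) := by
  have hc : Continuous (fun q : M2 × (Fin 2 → ℝ) => q.1 *ᵥ q.2) :=
    Continuous.matrix_mulVec continuous_fst continuous_snd
  exact (hc.tendsto (B, v)).comp (hA.prodMk_nhds hw)

lemma sq_ne {f : Fin 2 → ℝ} (hf : f ≠ 0) : f 0 ^ 2 + f 1 ^ 2 ≠ 0 := by
  intro h
  apply hf
  ext i
  fin_cases i
  · show f 0 = 0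
    nlinarith [sq_nonneg (f 0), sq_nonneg (f 1)]
  · show f 1 = 0
    nlinarith [sq_nonneg (f 0), sq_nonneg (f 1)]

noncomputable def KM (f : Fin 2 → ℝ) : M2 :=
  !![f 0, -(f 1) / (f 0 ^ 2 + f 1 ^ 2); f 1, f 0 / (f 0 ^ 2 + f 1 ^ 2)]

lemma KM_det {f : Fin 2 → ℝ} (hf : f ≠ 0) : (KM f).det = 1 := by
  have := sq_ne hf
  simp only [KM, Matrix.det_fin_two_of]
  field_simp
  ring

open Classical in
noncomputable def KS (f : Fin 2 → ℝ) : SL2 :=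
  if h : f = 0 then 1 else ⟨KM f, KM_det h⟩

lemma KS_coe {f : Fin 2 → ℝ} (hf : f ≠ 0) : (KS f : M2) = KM f := by
  simp [KS, hf]

lemma KS_e1 {f : Fin 2 → ℝ} (hf : f ≠ 0) : (KS f : M2) *ᵥ ![1, 0] = f := by
  rw [KS_coe hf]
  ext i
  fin_cases i <;> simp [KM]

lemma KSinv {f : Fin 2 → ℝ} (hf : f ≠ 0) : ((KS f)⁻¹ : SL2).1 *ᵥ f = ![1, 0] := by
  conv_lhs => rw [← KS_e1 hf]
  change (((KS _)⁻¹ : SL2) : M2) *ᵥ ((KS _ : M2) *ᵥ _) = _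
  rw [Matrix.mulVec_mulVec, KS_e1 hf, ← Matrix.SpecialLinearGroup.coe_mul]
  simp

lemma KS_tendsto {f : ℕ → Fin 2 → ℝ} {e : Fin 2 → ℝ} (he : e ≠ 0)
    (hf : Tendsto f atTop (𝓝 e)) :
    Tendsto (fun n => (KS (f n) : M2)) atTop (𝓝 (KS e : M2)) := by
  have hev : ∀ᶠ n in atTop, f n ≠ 0 := hf.eventually_ne he
  rw [KS_coe he]
  have h0 : Tendsto (fun n => f n 0) atTop (𝓝 (e 0)) := (tendsto_pi_nhds.1 hf) 0
  have h1 : Tendsto (fun n => f n 1) atTop (𝓝 (e 1)) := (tendsto_pi_nhds.1 hf) 1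
  have hq := (h0.pow 2).add (h1.pow 2)
  have : Tendsto (fun n => KM (f n)) atTop (𝓝 (KM e)) := by
    refine tendsto_pi_nhds.2 fun i => tendsto_pi_nhds.2 fun j => ?_
    fin_cases i <;> fin_cases j
    · simpa [KM] using h0
    · exact h1.neg.div hq (sq_ne he)
    · simpa [KM] using h1
    · exact h0.div hq (sq_ne he)
  refine this.congr' ?_
  filter_upwards [hev] with n hn
  exact (KS_coe hn).symm

lemma unip_of_fix (A : SL2) (h : (A : M2) *ᵥ ![1, 0] = ![1, 0]) :
    (A : M2) = !![1, (A : M2) 0 1; 0, 1] := by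
  have h0 := congrFun h 0
  have h1 := congrFun h 1
  have hd := A.det_coe
  rw [Matrix.det_fin_two] at hd
  simp [Matrix.mulVec, dotProduct] at h0 h1
  rw [h0, h1] at hd
  ext i j
  fin_cases i <;> fin_cases j
  · simpa using h0
  · simp
  · simpa using h1
  · simpa using hd

lemma mem_conj_N {e : Fin 2 → ℝ} (he : e ≠ 0) (p : GSL) :
    p ∈ conjSet ⟨KS e, 0⟩ NplusR2 ↔ (p.g : M2) *ᵥ e = e := by
  constructor
  · rintro ⟨s, ⟨x, hx⟩, rfl⟩
    change ((KS e * s.g * (KS e)⁻¹ : SL2) : M2) *ᵥ e = e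
    rw [Matrix.SpecialLinearGroup.coe_mul, ← Matrix.mulVec_mulVec, KSinv he,
      Matrix.SpecialLinearGroup.coe_mul, ← Matrix.mulVec_mulVec, hx]
    have : !![1, x; 0, 1] *ᵥ ![1, 0] = ![1, (0 : ℝ)] := by
      ext i
      fin_cases i <;> simp
    rw [this, KS_e1 he]
  · intro h
    refine ⟨(⟨KS e, 0⟩ : GSL)⁻¹ * p * ⟨KS e, 0⟩, ?_, by group⟩
    refine ⟨_, unip_of_fix ((KS e)⁻¹ * p.g * KS e) ?_⟩
    rw [Matrix.SpecialLinearGroup.coe_mul, ← Matrix.mulVec_mulVec, KS_e1 he,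
      Matrix.SpecialLinearGroup.coe_mul, ← Matrix.mulVec_mulVec, h]
    exact KSinv he

theorem chabauty_limit_of_levi (x : ℕ → GSL) (H : Subgroup GSL)
    (hclosed : IsClosed (H : Set GSL))
    (hlim : ChabautyTendsto (fun n => conjSet (x n) LeviL) (H : Set GSL)) :
    (∃ y : GSL, (H : Set GSL) = conjSet y LeviL) ∨
      (∃ y : GSL, (H : Set GSL) = conjSet y NplusR2) := by
  obtain ⟨hl1, hl2⟩ := hlim
  by_cases hb : Tendsto (fun n => ‖(x n).v‖) atTop atTop
  · right
    obtain ⟨e, -, φ, hφ, hlim⟩ := (isCompact_closedBall (0 : Fin 2 → ℝ) 1).tendsto_subseq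
      (x := fun n => ‖(x n).v‖⁻¹ • (x n).v) (fun n => by
        rw [mem_closedBall_zero_iff, norm_smul, norm_inv, norm_norm]
        exact inv_mul_le_one)
    have hr : Tendsto (fun n => ‖(x (φ n)).v‖) atTop atTop := hb.comp hφ.tendsto_atTop
    have hri : Tendsto (fun n => ‖(x (φ n)).v‖⁻¹) atTop (𝓝 0) := hr.inv_tendsto_atTop
    have hpos : ∀ᶠ n in atTop, 0 < ‖(x (φ n)).v‖ := hr.eventually_gt_atTop 0
    change Tendsto (fun n => ‖(x (φ n)).v‖⁻¹ • (x (φ n)).v) atTop (𝓝 e) at hlim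
    have he : e ≠ 0 := by
      rintro rfl
      have h1 := hlim.norm
      have h2 : Tendsto (fun n => ‖‖(x (φ n)).v‖⁻¹ • (x (φ n)).v‖) atTop (𝓝 1) := by
        refine tendsto_const_nhds.congr' ?_
        filter_upwards [hpos] with n hn
        rw [norm_smul, norm_inv, norm_norm, inv_mul_cancel₀ hn.ne']
      have := tendsto_nhds_unique h1 h2
      simp at this
    refine ⟨⟨KS e, 0⟩, ?_⟩
    ext p
    rw [mem_conj_N he]
    constructor
    · intro hp
      obtain ⟨u, hu, hut⟩ := hl1 p hp
      have hut := (gsl_tendsto _ _).1 (hut.comp hφ.tendsto_atTop)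
      have h1 := hri.smul hut.2
      have h2 := hlim.sub (tendsto_mulVec hut.1 hlim)
      have h3 := tendsto_nhds_unique (h2.congr fun n => ?_) h1
      · rw [zero_smul, sub_eq_zero] at h3
        exact h3.symm
      · have := (mem_conj_levi _ _).1 (hu (φ n))
        simp only [Function.comp_apply, this, Matrix.mulVec_smul, smul_sub]
    · intro hp
      set N : SL2 := (KS e)⁻¹ * p.g * KS e with hN
      have hNe : (N : M2) *ᵥ ![1, 0] = ![1, 0] := by
        rw [hN, Matrix.SpecialLinearGroup.coe_mul, ← Matrix.mulVec_mulVec, KS_e1 he,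
          Matrix.SpecialLinearGroup.coe_mul, ← Matrix.mulVec_mulVec, hp]
        exact KSinv he
      have hpN : p.g = KS e * N * (KS e)⁻¹ := by rw [hN]; group
      set en : ℕ → Fin 2 → ℝ := fun n => ‖(x (φ n)).v‖⁻¹ • (x (φ n)).v with hen
      set f : ℕ → Fin 2 → ℝ := fun n => en n - ‖(x (φ n)).v‖⁻¹ • p.v with hfdef
      have hf : Tendsto f atTop (𝓝 e) := by
        simpa using hlim.sub (hri.smul_const p.v)
      set h : ℕ → SL2 := fun n => KS (f n) * N * (KS (en n))⁻¹ with hh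
      refine hl2 φ hφ (fun n => ⟨h n, (x (φ n)).v - (h n : M2) *ᵥ (x (φ n)).v⟩)
        (fun n => (mem_conj_levi _ _).2 rfl) p ((gsl_tendsto _ _).2 ⟨?_, ?_⟩)
      · rw [hpN]
        simp only [hh, Matrix.SpecialLinearGroup.coe_mul, Matrix.SpecialLinearGroup.coe_inv]
        refine ((KS_tendsto he hf).mul tendsto_const_nhds).mul ?_
        have hc : Continuous (fun A : M2 => A.adjugate) := Continuous.matrix_adjugate continuous_id
        exact (hc.tendsto _).comp (KS_tendsto he hlim)
      · refine tendsto_const_nhds.congr' ?_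
        filter_upwards [hpos, hf.eventually_ne he, hlim.eventually_ne he] with n hn hfn hen0
        have hhe : (h n : M2) *ᵥ en n = f n := by
          rw [hh]
          simp only
          rw [Matrix.SpecialLinearGroup.coe_mul, ← Matrix.mulVec_mulVec, KSinv hen0,
            Matrix.SpecialLinearGroup.coe_mul, ← Matrix.mulVec_mulVec, hNe, KS_e1 hfn]
        have hx : (x (φ n)).v = ‖(x (φ n)).v‖ • en n := by
          rw [hen]
          simp only
          rw [smul_smul, mul_inv_cancel₀ hn.ne', one_smul]
        have : (h n : M2) *ᵥ (x (φ n)).v = ‖(x (φ n)).v‖ • f n := by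
          conv_lhs => rw [hx]
          rw [Matrix.mulVec_smul, hhe]
        simp only [this]
        rw [hfdef]
        simp only
        rw [smul_sub, ← hx, smul_smul, mul_inv_cancel₀ hn.ne', one_smul]
        abel
  · left
    rw [tendsto_atTop] at hb
    push Not at hb
    obtain ⟨C, hC⟩ := hb
    have hfr : ∃ᶠ n in atTop, (x n).v ∈ Metric.closedBall (0 : Fin 2 → ℝ) C := by
      refine hC.mono fun n hn => ?_
      rw [mem_closedBall_zero_iff]
      exact hn.le
    obtain ⟨w, -, φ, hφ, hw⟩ := tendsto_subseq_of_frequently_bounded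
      Metric.isBounded_closedBall hfr
    change Tendsto (fun n => (x (φ n)).v) atTop (𝓝 w) at hw
    refine ⟨⟨1, w⟩, ?_⟩
    ext p
    rw [mem_conj_levi]
    constructor
    · intro hp
      obtain ⟨u, hu, hut⟩ := hl1 p hp
      have hut := (gsl_tendsto _ _).1 (hut.comp hφ.tendsto_atTop)
      refine tendsto_nhds_unique hut.2 ((hw.sub (tendsto_mulVec hut.1 hw)).congr fun n => ?_)
      exact ((mem_conj_levi _ _).1 (hu (φ n))).symm
    · intro hp
      refine hl2 φ hφ (fun n => ⟨p.g, (x (φ n)).v - (p.g : M2) *ᵥ (x (φ n)).v⟩)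
        (fun n => (mem_conj_levi _ _).2 rfl) p ((gsl_tendsto _ _).2 ⟨tendsto_const_nhds, ?_⟩)
      rw [hp]
      exact hw.sub (tendsto_mulVec tendsto_const_nhds hw)
end

section
/- Let A = {(diag(a,1/a), 0) : a > 0} ⊂ G, and for a,b,c ∈ ℝ let V_{(a,b,c)} = {((1, at; 0, 1), (ct + abt²/2, bt)) : t ∈ ℝ} ⊂ G. Then a closed subgroup H of G lies in the Chabauty closure of {(g,v) A (g,v)⁻¹ : (g,v) ∈ G} if and only if H is a conjugate in G of A, or a conjugate in G of V_{(a,b,c)} for some a,b,c ∈ ℝ with a = 1 or b = 1. -/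
open Matrix Filter Topology

/-- The diagonal subgroup `A = {(diag(a, 1/a), 0) : a > 0}` of `G`. -/
def Aset : Set GSL := {p | (∃ a : ℝ, 0 < a ∧ (p.g : M2) = !![a, 0; 0, a⁻¹]) ∧ p.v = 0}

/-- The one-parameter subgroup `V_{(a,b,c)} = {((1, a t; 0, 1), (c t + a b t²/2, b t)) : t ∈ ℝ}`. -/
def Vabc (a b c : ℝ) : Set GSL :=
  {p | ∃ t : ℝ, (p.g : M2) = !![1, a * t; 0, 1] ∧ p.v = ![c * t + a * b * t ^ 2 / 2, b * t]}


namespace ChabautyAux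

/-- The quadratic invariant (minus the determinant) of a Lie algebra element. -/
noncomputable def dd (θ : Fin 5 → ℝ) : ℝ := θ 0 ^ 2 + θ 1 * θ 2

noncomputable def rr (θ : Fin 5 → ℝ) (σ : ℝ) : ℝ := Real.sqrt (1 + dd θ * σ ^ 2)

/-- `h` is the point of parameter `σ` on the one-parameter group attached to `θ`. -/
structure Crd (θ : Fin 5 → ℝ) (σ : ℝ) (h : GSL) : Prop where
  h00 : (h.g : M2) 0 0 = rr θ σ + σ * θ 0
  h01 : (h.g : M2) 0 1 = σ * θ 1
  h10 : (h.g : M2) 1 0 = σ * θ 2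
  h11 : (h.g : M2) 1 1 = rr θ σ - σ * θ 0
  hv0 : h.v 0 = σ ^ 2 / (1 + rr θ σ) * (θ 0 * θ 3 + θ 1 * θ 4) + σ * θ 3
  hv1 : h.v 1 = σ ^ 2 / (1 + rr θ σ) * (θ 2 * θ 3 - θ 0 * θ 4) + σ * θ 4

def RR (θ : Fin 5 → ℝ) : Set GSL := {h | ∃ σ, Crd θ σ h}

lemma rr_nonneg (θ : Fin 5 → ℝ) (σ : ℝ) : 0 ≤ rr θ σ := Real.sqrt_nonneg _

lemma rr_sq {θ : Fin 5 → ℝ} (hd : 0 ≤ dd θ) (σ : ℝ) : rr θ σ ^ 2 = 1 + dd θ * σ ^ 2 :=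
  Real.sq_sqrt (by positivity)

lemma gsl_ext {h k : GSL} (h00 : (h.g : M2) 0 0 = (k.g : M2) 0 0)
    (h01 : (h.g : M2) 0 1 = (k.g : M2) 0 1) (h10 : (h.g : M2) 1 0 = (k.g : M2) 1 0)
    (h11 : (h.g : M2) 1 1 = (k.g : M2) 1 1) (hv0 : h.v 0 = k.v 0) (hv1 : h.v 1 = k.v 1) :
    h = k := by
  obtain ⟨g, v⟩ := h
  obtain ⟨g', v'⟩ := k
  congr 1
  · ext i j
    fin_cases i <;> fin_cases j <;> assumption
  · ext i
    fin_cases i <;> assumption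

lemma Crd.unique {θ : Fin 5 → ℝ} {σ : ℝ} {h k : GSL} (a : Crd θ σ h) (b : Crd θ σ k) : h = k :=
  gsl_ext (a.h00.trans b.h00.symm) (a.h01.trans b.h01.symm) (a.h10.trans b.h10.symm)
    (a.h11.trans b.h11.symm) (a.hv0.trans b.hv0.symm) (a.hv1.trans b.hv1.symm)

lemma crd_exists {θ : Fin 5 → ℝ} (hd : 0 ≤ dd θ) (σ : ℝ) : ∃ h, Crd θ σ h := by
  refine ⟨⟨⟨!![rr θ σ + σ * θ 0, σ * θ 1; σ * θ 2, rr θ σ - σ * θ 0], ?_⟩,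
    ![σ ^ 2 / (1 + rr θ σ) * (θ 0 * θ 3 + θ 1 * θ 4) + σ * θ 3,
      σ ^ 2 / (1 + rr θ σ) * (θ 2 * θ 3 - θ 0 * θ 4) + σ * θ 4]⟩, ?_⟩
  · rw [Matrix.det_fin_two_of]
    have := rr_sq hd σ
    unfold dd at this
    linear_combination this
  · constructor <;> simp

lemma crd_smul {θ : Fin 5 → ℝ} (c σ : ℝ) (h : GSL) : Crd (c • θ) σ h ↔ Crd θ (c * σ) h := by
  have hr : rr (c • θ) σ = rr θ (c * σ) := by
    unfold rr dd
    congr 1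
    simp only [Pi.smul_apply, smul_eq_mul]
    ring
  constructor
  · rintro ⟨h1, h2, h3, h4, h5, h6⟩
    rw [hr] at *
    simp only [Pi.smul_apply, smul_eq_mul] at *
    constructor
    · rw [h1]; ring
    · rw [h2]; ring
    · rw [h3]; ring
    · rw [h4]; ring
    · rw [h5]; ring
    · rw [h6]; ring
  · rintro ⟨h1, h2, h3, h4, h5, h6⟩
    constructor <;> (try rw [hr]) <;> simp only [Pi.smul_apply, smul_eq_mul]
    · rw [h1]; ring
    · rw [h2]; ring
    · rw [h3]; ring
    · rw [h4]; ring
    · rw [h5]; ring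
    · rw [h6]; ring

lemma RR_smul (θ : Fin 5 → ℝ) {c : ℝ} (hc : c ≠ 0) : RR (c • θ) = RR θ := by
  ext h
  constructor
  · rintro ⟨σ, hσ⟩
    exact ⟨_, (crd_smul c σ h).1 hσ⟩
  · rintro ⟨σ, hσ⟩
    refine ⟨c⁻¹ * σ, (crd_smul c _ h).2 ?_⟩
    rwa [mul_inv_cancel_left₀ hc]

lemma dd_smul (θ : Fin 5 → ℝ) (c : ℝ) : dd (c • θ) = c ^ 2 * dd θ := by
  simp only [dd, Pi.smul_apply, smul_eq_mul]; ring

/-- The adjoint action. -/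
noncomputable def act (u : GSL) (θ : Fin 5 → ℝ) : Fin 5 → ℝ :=
  let α := (u.g : M2) 0 0
  let β := (u.g : M2) 0 1
  let γ := (u.g : M2) 1 0
  let ε := (u.g : M2) 1 1
  let x := (α * θ 0 + β * θ 2) * ε - (α * θ 1 - β * θ 0) * γ
  let y := -(α * θ 0 + β * θ 2) * β + (α * θ 1 - β * θ 0) * α
  let w := (γ * θ 0 + ε * θ 2) * ε - (γ * θ 1 - ε * θ 0) * γ
  ![x, y, w, α * θ 3 + β * θ 4 - (x * u.v 0 + y * u.v 1),
    γ * θ 3 + ε * θ 4 - (w * u.v 0 - x * u.v 1)]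

lemma det_eq (u : SL2) : (u : M2) 0 0 * (u : M2) 1 1 - (u : M2) 0 1 * (u : M2) 1 0 = 1 := by
  rw [← Matrix.det_fin_two]; exact u.2

lemma dd_act (u : GSL) (θ : Fin 5 → ℝ) : dd (act u θ) = dd θ := by
  have h := det_eq u.g
  simp only [dd, act, Matrix.cons_val]
  generalize (u.g : M2) 0 0 = α at *
  generalize (u.g : M2) 0 1 = β at *
  generalize (u.g : M2) 1 0 = γ at *
  generalize (u.g : M2) 1 1 = ε at *
  have : (θ 0 ^ 2 + θ 1 * θ 2) = (α * ε - β * γ) ^ 2 * (θ 0 ^ 2 + θ 1 * θ 2) := by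
    rw [h]; ring
  rw [this]
  ring

lemma crd_conj {θ : Fin 5 → ℝ} (hd : 0 ≤ dd θ) (u : GSL) {σ : ℝ} {h : GSL} (hc : Crd θ σ h) :
    Crd (act u θ) σ (u * h * u⁻¹) := by
  have hr : rr (act u θ) σ = rr θ σ := by unfold rr; rw [dd_act]
  have hsq := rr_sq hd σ
  have hdet := det_eq u.g
  have hne : 1 + rr θ σ ≠ 0 := by have := rr_nonneg θ σ; positivity
  obtain ⟨h1, h2, h3, h4, h5, h6⟩ := hc
  have hk : σ ^ 2 / (1 + rr θ σ) * dd θ = rr θ σ - 1 := by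
    field_simp; linear_combination -hsq
  unfold dd at hk
  generalize hkk : σ ^ 2 / (1 + rr θ σ) = k at *
  have e00 : ((u.g⁻¹ : SL2) : M2) 0 0 = (u.g : M2) 1 1 := by
    simp [Matrix.SpecialLinearGroup.coe_inv, Matrix.adjugate_fin_two]
  have e01 : ((u.g⁻¹ : SL2) : M2) 0 1 = -(u.g : M2) 0 1 := by
    simp [Matrix.SpecialLinearGroup.coe_inv, Matrix.adjugate_fin_two]
  have e10 : ((u.g⁻¹ : SL2) : M2) 1 0 = -(u.g : M2) 1 0 := by
    simp [Matrix.SpecialLinearGroup.coe_inv, Matrix.adjugate_fin_two]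
  have e11 : ((u.g⁻¹ : SL2) : M2) 1 1 = (u.g : M2) 0 0 := by
    simp [Matrix.SpecialLinearGroup.coe_inv, Matrix.adjugate_fin_two]
  constructor <;> (try rw [hr]) <;> (try rw [hkk]) <;>
    simp only [GSL.mul_def, GSL.inv_def, act, Matrix.cons_val, Matrix.SpecialLinearGroup.coe_mul,
      Matrix.mul_apply, Fin.sum_univ_two, Matrix.mulVec, dotProduct, Pi.add_apply, Pi.neg_apply,
      h1, h2, h3, h4, h5, h6, e00, e01, e10, e11] <;>
    generalize (u.g : M2) 0 0 = α at * <;>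
    generalize (u.g : M2) 0 1 = β at * <;>
    generalize (u.g : M2) 1 0 = γ at * <;>
    generalize (u.g : M2) 1 1 = ε at * <;>
    generalize rr θ σ = r at *
  · linear_combination r * hdet
  · ring
  · ring
  · linear_combination r * hdet
  · linear_combination (α * ε - β * γ) ^ 2 * u.v 0 * hk +
      (u.v 0 * ((r - 1) * (α * ε - β * γ) - 1) -
        k * (α * (θ 0 * θ 3 + θ 1 * θ 4) + β * (θ 2 * θ 3 - θ 0 * θ 4))) * hdet
  · linear_combination (α * ε - β * γ) ^ 2 * u.v 1 * hk +
      (u.v 1 * ((r - 1) * (α * ε - β * γ) - 1) -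
        k * (γ * (θ 0 * θ 3 + θ 1 * θ 4) + ε * (θ 2 * θ 3 - θ 0 * θ 4))) * hdet

lemma RR_conj {θ : Fin 5 → ℝ} (hd : 0 ≤ dd θ) (u : GSL) :
    conjSet u (RR θ) = RR (act u θ) := by
  ext h
  constructor
  · rintro ⟨k, ⟨σ, hσ⟩, rfl⟩
    exact ⟨σ, crd_conj hd u hσ⟩
  · rintro ⟨σ, hσ⟩
    obtain ⟨k, hk⟩ := crd_exists hd σ
    exact ⟨k, ⟨σ, hk⟩, (crd_conj hd u hk).unique hσ⟩

noncomputable def eA : Fin 5 → ℝ := ![1, 0, 0, 0, 0]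

lemma dd_eA : dd eA = 1 := by simp [dd, eA]

lemma dd_V (a b c : ℝ) : dd ![0, a, 0, c, b] = 0 := by simp [dd]

lemma Aset_eq : Aset = RR eA := by
  ext h
  constructor
  · rintro ⟨⟨a, ha, hg⟩, hv⟩
    have hr : rr eA ((a - a⁻¹) / 2) = (a + a⁻¹) / 2 := by
      unfold rr
      rw [dd_eA, Real.sqrt_eq_iff_mul_self_eq_of_pos (by positivity)]
      field_simp
      ring
    refine ⟨(a - a⁻¹) / 2, ?_⟩
    constructor <;> (try rw [hr]) <;> simp [hg, hv, eA] <;> ring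
  · rintro ⟨σ, h1, h2, h3, h4, h5, h6⟩
    have hsq := rr_sq (θ := eA) (by rw [dd_eA]; norm_num) σ
    have h0 := rr_nonneg eA σ
    rw [dd_eA] at hsq
    have hpos : 0 < rr eA σ + σ := by
      by_contra hcon
      nlinarith
    have hinv : (rr eA σ + σ)⁻¹ = rr eA σ - σ := by
      rw [inv_eq_iff_eq_inv, eq_comm, inv_eq_iff_eq_inv]
      apply eq_inv_of_mul_eq_one_left
      linear_combination hsq
    refine ⟨⟨rr eA σ + σ, hpos, ?_⟩, ?_⟩
    · rw [hinv]
      ext i j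
      fin_cases i <;> fin_cases j <;> simp [h1, h2, h3, h4] <;> simp [eA]
    · ext i
      fin_cases i <;> simp [h5, h6] <;> simp [eA]

lemma V_eq (a b c : ℝ) : Vabc a b c = RR ![0, a, 0, c, b] := by
  have hr : ∀ σ, rr ![0, a, 0, c, b] σ = 1 := by
    intro σ; unfold rr; rw [dd_V]; simp
  ext h
  constructor
  · rintro ⟨t, hg, hv⟩
    refine ⟨t, ?_⟩
    constructor <;> (try rw [hr]) <;> simp [hg, hv] <;> ring
  · rintro ⟨t, h1, h2, h3, h4, h5, h6⟩
    rw [hr] at *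
    refine ⟨t, ?_, ?_⟩
    · ext i j
      fin_cases i <;> fin_cases j <;> simp [h1, h2, h3, h4] <;> ring
    · ext i
      fin_cases i <;> simp [h5, h6] <;> ring

lemma tendsto_gsl {ι : Type*} {l : Filter ι} {u : ι → GSL} {h : GSL} :
    Tendsto u l (𝓝 h) ↔
      Tendsto (fun n => ((u n).g : M2) 0 0) l (𝓝 ((h.g : M2) 0 0)) ∧
      Tendsto (fun n => ((u n).g : M2) 0 1) l (𝓝 ((h.g : M2) 0 1)) ∧
      Tendsto (fun n => ((u n).g : M2) 1 0) l (𝓝 ((h.g : M2) 1 0)) ∧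
      Tendsto (fun n => ((u n).g : M2) 1 1) l (𝓝 ((h.g : M2) 1 1)) ∧
      Tendsto (fun n => (u n).v 0) l (𝓝 (h.v 0)) ∧
      Tendsto (fun n => (u n).v 1) l (𝓝 (h.v 1)) := by
  rw [(show IsInducing (fun p : GSL => (p.g, p.v)) from ⟨rfl⟩).tendsto_nhds_iff]
  rw [Prod.tendsto_iff]
  rw [(show IsInducing (fun g : SL2 => (g : M2)) from ⟨rfl⟩).tendsto_nhds_iff]
  have hm : Tendsto ((fun g : SL2 => (g : M2)) ∘ fun n => ((fun p : GSL => (p.g, p.v)) ∘ u) n |>.1)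
      l (𝓝 (h.g : M2)) ↔ ∀ i j, Tendsto (fun n => ((u n).g : M2) i j) l (𝓝 ((h.g : M2) i j)) := by
    refine (tendsto_pi_nhds (f := fun n => ((u n).g : M2)) (g := (h.g : M2))).trans ?_
    exact forall_congr' fun i => tendsto_pi_nhds
  refine (and_congr_left' hm).trans ?_
  simp only [tendsto_pi_nhds, Fin.forall_fin_two, Function.comp_def]
  tauto

lemma tendsto_rr {ι : Type*} {l : Filter ι} {Θ : ι → Fin 5 → ℝ} {θ : Fin 5 → ℝ}
    (hΘ : Tendsto Θ l (𝓝 θ)) {s : ι → ℝ} {σ : ℝ} (hs : Tendsto s l (𝓝 σ)) :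
    Tendsto (fun n => rr (Θ n) (s n)) l (𝓝 (rr θ σ)) := by
  have h := tendsto_pi_nhds.1 hΘ
  unfold rr dd
  exact ((((h 0).pow 2).add ((h 1).mul (h 2))).mul (hs.pow 2) |>.const_add 1).sqrt

lemma tendsto_crd {ι : Type*} {l : Filter ι} {Θ : ι → Fin 5 → ℝ} {θ : Fin 5 → ℝ}
    (hΘ : Tendsto Θ l (𝓝 θ)) {s : ι → ℝ} {σ : ℝ} (hs : Tendsto s l (𝓝 σ))
    {u : ι → GSL} {h : GSL} (hu : ∀ n, Crd (Θ n) (s n) (u n)) (hh : Crd θ σ h) :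
    Tendsto u l (𝓝 h) := by
  have ht := tendsto_pi_nhds.1 hΘ
  have hr := tendsto_rr hΘ hs
  have hne : 1 + rr θ σ ≠ 0 := by have := rr_nonneg θ σ; positivity
  rw [tendsto_gsl, hh.h00, hh.h01, hh.h10, hh.h11, hh.hv0, hh.hv1]
  simp only [fun n => (hu n).h00, fun n => (hu n).h01, fun n => (hu n).h10, fun n => (hu n).h11,
    fun n => (hu n).hv0, fun n => (hu n).hv1]
  have hk := (hs.pow 2).div (hr.const_add 1) hne
  refine ⟨hr.add (hs.mul (ht 0)), hs.mul (ht 1), hs.mul (ht 2), hr.sub (hs.mul (ht 0)),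
    (hk.mul (((ht 0).mul (ht 3)).add ((ht 1).mul (ht 4)))).add (hs.mul (ht 3)),
    (hk.mul (((ht 2).mul (ht 3)).sub ((ht 0).mul (ht 4)))).add (hs.mul (ht 4))⟩

instance : T2Space GSL := by
  have hi : Function.Injective (fun p : GSL => ((p.g : M2), p.v)) := by
    rintro ⟨g, v⟩ ⟨g', v'⟩ h
    simp only [Prod.mk.injEq] at h
    obtain ⟨h1, h2⟩ := h
    congr 1
    exact Subtype.ext h1
  have hc : Continuous (fun p : GSL => ((p.g : M2), p.v)) := by
    have h1 : Continuous (fun g : SL2 => (g : M2)) := continuous_induced_dom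
    have h2 : Continuous (fun p : GSL => (p.g, p.v)) := continuous_induced_dom
    exact (h1.comp (continuous_fst.comp h2)).prodMk (continuous_snd.comp h2)
  exact T2Space.of_injective_continuous hi hc

lemma tendsto_dd {ι : Type*} {l : Filter ι} {Θ : ι → Fin 5 → ℝ} {θ : Fin 5 → ℝ}
    (hΘ : Tendsto Θ l (𝓝 θ)) : Tendsto (fun n => dd (Θ n)) l (𝓝 (dd θ)) := by
  have h := tendsto_pi_nhds.1 hΘ
  exact ((h 0).pow 2).add ((h 1).mul (h 2))

/-- Properness: parameters cannot escape to infinity. -/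
lemma no_escape {Θ : ℕ → Fin 5 → ℝ} {θ : Fin 5 → ℝ}
    (hΘ : Tendsto Θ atTop (𝓝 θ)) (hd : ∀ n, 0 ≤ dd (Θ n)) (h0 : θ ≠ 0)
    {s : ℕ → ℝ} {x : ℕ → GSL} {h : GSL} (hx : ∀ n, Crd (Θ n) (s n) (x n))
    (hlim : Tendsto x atTop (𝓝 h)) : ¬ Tendsto (fun n => ‖s n‖) atTop atTop := by
  intro hs
  have ht := tendsto_pi_nhds.1 hΘ
  obtain ⟨l1, l2, l3, l4, l5, l6⟩ := tendsto_gsl.1 hlim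
  have hi : Tendsto (fun n => (s n)⁻¹) atTop (𝓝 0) :=
    tendsto_inv₀_cobounded.comp (tendsto_norm_atTop_iff_cobounded.1 hs)
  have hsne : ∀ᶠ n in atTop, s n ≠ 0 := by
    filter_upwards [hs.eventually_gt_atTop 0] with n hn
    exact norm_pos_iff.1 hn
  have key : ∀ {f : ℕ → ℝ} {m e : ℝ}, Tendsto (fun n => s n * f n) atTop (𝓝 m) →
      Tendsto f atTop (𝓝 e) → e = 0 := by
    intro f m e hf he
    have h1 : Tendsto (fun n => (s n)⁻¹ * (s n * f n)) atTop (𝓝 (0 * m)) := hi.mul hf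
    rw [zero_mul] at h1
    refine tendsto_nhds_unique he (h1.congr' ?_)
    filter_upwards [hsne] with n hn
    rw [inv_mul_cancel_left₀ hn]
  -- the trace and the matrix part
  have hr : Tendsto (fun n => rr (Θ n) (s n)) atTop
      (𝓝 (((h.g : M2) 0 0 + (h.g : M2) 1 1) / 2)) := by
    refine ((l1.add l4).div_const 2).congr fun n => ?_
    rw [(hx n).h00, (hx n).h11]; ring
  have hX : Tendsto (fun n => s n * Θ n 0) atTop
      (𝓝 (((h.g : M2) 0 0 - (h.g : M2) 1 1) / 2)) := by
    refine ((l1.sub l4).div_const 2).congr fun n => ?_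
    rw [(hx n).h00, (hx n).h11]; ring
  have hY := l2.congr fun n => (hx n).h01
  have hW := l3.congr fun n => (hx n).h10
  have z0 : θ 0 = 0 := key hX (ht 0)
  have z1 : θ 1 = 0 := key hY (ht 1)
  have z2 : θ 2 = 0 := key hW (ht 2)
  generalize ((h.g : M2) 0 0 + (h.g : M2) 1 1) / 2 = r at *
  generalize ((h.g : M2) 0 0 - (h.g : M2) 1 1) / 2 = X at *
  generalize (h.g : M2) 0 1 = Y at *
  generalize (h.g : M2) 1 0 = W at *
  have hr0 : 0 ≤ r := ge_of_tendsto' hr fun n => rr_nonneg _ _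
  have hrne : 1 + r ≠ 0 := by positivity
  have hdet : r ^ 2 = 1 + (X ^ 2 + Y * W) := by
    refine tendsto_nhds_unique (hr.pow 2)
      ((((hX.pow 2).add (hY.mul hW)).const_add 1).congr fun n => ?_)
    rw [rr_sq (hd n)]; unfold dd; ring
  have hne : ∀ n, 1 + rr (Θ n) (s n) ≠ 0 := fun n => by
    have := rr_nonneg (Θ n) (s n); positivity
  have q0 : ((X * θ 3 + Y * θ 4) / (1 + r) + θ 3) = 0 := by
    refine key (f := fun n => (s n * Θ n 0 * Θ n 3 + s n * Θ n 1 * Θ n 4) / (1 + rr (Θ n) (s n))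
      + Θ n 3) (m := h.v 0) (l5.congr fun n => ?_) ?_
    · rw [(hx n).hv0]; have := hne n; field_simp
    · exact (((hX.mul (ht 3)).add (hY.mul (ht 4))).div (hr.const_add 1) hrne).add (ht 3)
  have q1 : ((W * θ 3 - X * θ 4) / (1 + r) + θ 4) = 0 := by
    refine key (f := fun n => (s n * Θ n 2 * Θ n 3 - s n * Θ n 0 * Θ n 4) / (1 + rr (Θ n) (s n))
      + Θ n 4) (m := h.v 1) (l6.congr fun n => ?_) ?_
    · rw [(hx n).hv1]; have := hne n; field_simp
    · exact (((hW.mul (ht 3)).sub (hX.mul (ht 4))).div (hr.const_add 1) hrne).add (ht 4)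
  field_simp at q0 q1
  have z3 : θ 3 = 0 := by
    have : 2 * (1 + r) * θ 3 = 0 := by
      linear_combination (1 + r - X) * q0 - Y * q1 + θ 3 * -hdet
    exact (mul_eq_zero.1 this).resolve_left (by positivity)
  have z4 : θ 4 = 0 := by
    have : 2 * (1 + r) * θ 4 = 0 := by
      linear_combination (1 + r + X) * q1 - W * q0 + θ 4 * -hdet
    exact (mul_eq_zero.1 this).resolve_left (by positivity)
  apply h0
  ext i
  fin_cases i <;> assumption

theorem RR_tendsto {Θ : ℕ → Fin 5 → ℝ} {θ : Fin 5 → ℝ}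
    (hΘ : Tendsto Θ atTop (𝓝 θ)) (hd : ∀ n, 0 ≤ dd (Θ n)) (h0 : θ ≠ 0) :
    ChabautyTendsto (fun n => RR (Θ n)) (RR θ) := by
  have hdθ : 0 ≤ dd θ := ge_of_tendsto' (tendsto_dd hΘ) hd
  constructor
  · rintro h ⟨σ, hσ⟩
    choose u hu using fun n => crd_exists (hd n) σ
    exact ⟨u, fun n => ⟨σ, hu n⟩, tendsto_crd hΘ tendsto_const_nhds hu hσ⟩
  · intro k hk x hx l hl
    choose s hs using hx
    have hne := no_escape (hΘ.comp hk.tendsto_atTop) (fun n => hd (k n)) h0 hs hl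
    rw [tendsto_atTop] at hne
    push Not at hne
    obtain ⟨C, hC⟩ := hne
    have hfr : ∃ᶠ n in atTop, s n ∈ Metric.ball (0 : ℝ) C := by
      refine hC.mono fun n hn => ?_
      simpa using hn
    obtain ⟨σ, -, φ, hφ, hlim⟩ := tendsto_subseq_of_frequently_bounded Metric.isBounded_ball hfr
    obtain ⟨h, hh⟩ := crd_exists hdθ σ
    have h1 : Tendsto (x ∘ φ) atTop (𝓝 h) :=
      tendsto_crd ((hΘ.comp hk.tendsto_atTop).comp hφ.tendsto_atTop) hlim (fun n => hs (φ n)) hh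
    have := tendsto_nhds_unique (hl.comp hφ.tendsto_atTop) h1
    exact this ▸ ⟨σ, hh⟩

lemma chab_unique {X : Type*} [TopologicalSpace X] {H : ℕ → Set X} {L L' : Set X}
    (h : ChabautyTendsto H L) (h' : ChabautyTendsto H L') : L = L' := by
  apply Set.Subset.antisymm
  · intro x hx
    obtain ⟨u, hu, hl⟩ := h.1 x hx
    exact h'.2 id strictMono_id u hu x hl
  · intro x hx
    obtain ⟨u, hu, hl⟩ := h'.1 x hx
    exact h.2 id strictMono_id u hu x hl

lemma chab_sub {X : Type*} [TopologicalSpace X] {H : ℕ → Set X} {L : Set X}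
    (h : ChabautyTendsto H L) {φ : ℕ → ℕ} (hφ : StrictMono φ) :
    ChabautyTendsto (fun n => H (φ n)) L := by
  constructor
  · intro x hx
    obtain ⟨u, hu, hl⟩ := h.1 x hx
    exact ⟨u ∘ φ, fun n => hu _, hl.comp hφ.tendsto_atTop⟩
  · intro k hk x hx l hl
    exact h.2 (φ ∘ k) (hφ.comp hk) x hx l hl

lemma act_zero (u : GSL) : act u 0 = 0 := by
  ext i
  fin_cases i <;> simp [act]

lemma act_ne {u : GSL} {θ : Fin 5 → ℝ} (h : θ ≠ 0) : act u θ ≠ 0 := by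
  intro h0
  apply h
  have hdet := det_eq u.g
  have e0 := congrFun h0 0
  have e1 := congrFun h0 1
  have e2 := congrFun h0 2
  have e3 := congrFun h0 3
  have e4 := congrFun h0 4
  simp only [act, Matrix.cons_val, Pi.zero_apply] at e0 e1 e2 e3 e4
  rw [e0, e1] at e3
  rw [e0, e2] at e4
  generalize (u.g : M2) 0 0 = α at *
  generalize (u.g : M2) 0 1 = β at *
  generalize (u.g : M2) 1 0 = γ at *
  generalize (u.g : M2) 1 1 = ε at *
  have z3 : θ 3 = 0 := by
    linear_combination ε * e3 - β * e4 - θ 3 * hdet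
  have z4 : θ 4 = 0 := by
    linear_combination α * e4 - γ * e3 - θ 4 * hdet
  have z0 : θ 0 = 0 := by
    have : (α * ε - β * γ) ^ 2 * θ 0 = 0 := by
      linear_combination (α * ε + β * γ) * e0 + γ * ε * e1 - α * β * e2
    simpa [hdet] using this
  have z1 : θ 1 = 0 := by
    have : (α * ε - β * γ) ^ 2 * θ 1 = 0 := by
      linear_combination (2 * β * ε) * e0 + ε ^ 2 * e1 - β ^ 2 * e2
    simpa [hdet] using this
  have z2 : θ 2 = 0 := by
    have : (α * ε - β * γ) ^ 2 * θ 2 = 0 := by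
      linear_combination (-2 * α * γ) * e0 - γ ^ 2 * e1 + α ^ 2 * e2
    simpa [hdet] using this
  ext i
  fin_cases i <;> assumption

lemma act_cont (u : GSL) : Continuous (act u) := by
  refine continuous_pi fun i => ?_
  fin_cases i <;> simp only [act] <;> simp <;> fun_prop

lemma act_eA {θ : Fin 5 → ℝ} (hd : dd θ = 1) {α β γ ε : ℝ} (hdet : α * ε - β * γ = 1)
    (hx : α * ε + β * γ = θ 0) (hy : -2 * α * β = θ 1) (hw : 2 * γ * ε = θ 2) :
    ∃ u, act u eA = θ := by
  unfold dd at hd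
  refine ⟨⟨⟨!![α, β; γ, ε], by rw [Matrix.det_fin_two_of]; exact hdet⟩,
      ![-(θ 0 * θ 3 + θ 1 * θ 4), -(θ 2 * θ 3 - θ 0 * θ 4)]⟩, ?_⟩
  ext i
  fin_cases i <;> simp [act, eA]
  · linear_combination hx
  · linear_combination hy
  · linear_combination hw
  · linear_combination (θ 0 * θ 3 + θ 1 * θ 4) * hx + (θ 2 * θ 3 - θ 0 * θ 4) * hy + θ 3 * hd
  · linear_combination (θ 0 * θ 3 + θ 1 * θ 4) * hw - (θ 2 * θ 3 - θ 0 * θ 4) * hx + θ 4 * hd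

lemma class_one {θ : Fin 5 → ℝ} (hd : dd θ = 1) : ∃ u, act u eA = θ := by
  have hd' := hd
  unfold dd at hd'
  by_cases hx : θ 0 = -1
  · have hyw : θ 1 * θ 2 = 0 := by rw [hx] at hd'; linarith
    apply act_eA hd (α := θ 1) (β := -2 / 4) (γ := 2) (ε := θ 2 / 4) <;> linarith
  · have hx1 : θ 0 + 1 ≠ 0 := fun h => hx (by linarith)
    apply act_eA hd (α := θ 0 + 1) (β := -θ 1 / (2 * (θ 0 + 1))) (γ := θ 2) (ε := 1 / 2)
    · field_simp; linear_combination hd'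
    · field_simp; linear_combination -hd'
    · field_simp
    · ring

lemma class_pos {θ : Fin 5 → ℝ} (hd : 0 < dd θ) : ∃ u, conjSet u Aset = RR θ := by
  have hs : Real.sqrt (dd θ) ≠ 0 := (Real.sqrt_pos.2 hd).ne'
  obtain ⟨u, hu⟩ := class_one (θ := (Real.sqrt (dd θ))⁻¹ • θ) (by
    rw [dd_smul, inv_pow, Real.sq_sqrt hd.le, inv_mul_cancel₀ hd.ne'])
  refine ⟨u, ?_⟩
  rw [Aset_eq, RR_conj (by rw [dd_eA]; norm_num), hu, RR_smul _ (inv_ne_zero hs)]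

lemma conj_V (u : GSL) (a b c : ℝ) : conjSet u (Vabc a b c) = RR (act u ![0, a, 0, c, b]) := by
  rw [V_eq, RR_conj (dd_V a b c).ge]

lemma class_zero {θ : Fin 5 → ℝ} (hd : dd θ = 0) (h0 : θ ≠ 0) :
    ∃ a b c : ℝ, (a = 1 ∨ b = 1) ∧ ∃ y : GSL, RR θ = conjSet y (Vabc a b c) := by
  simp only [conj_V]
  by_cases h1 : θ 1 = 0
  · have hx : θ 0 = 0 := by simpa [dd, h1] using hd
    by_cases h2 : θ 2 = 0
    · by_cases h4 : θ 4 = 0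
      · have h3 : θ 3 ≠ 0 := by
          intro h3; apply h0; ext i; fin_cases i <;> assumption
        refine ⟨0, 1, 0, Or.inr rfl, ⟨⟨!![0, θ 3; -(θ 3)⁻¹, 0], ?_⟩, 0⟩, ?_⟩
        · rw [Matrix.det_fin_two_of]; field_simp; simp
        · congr 1; ext i; fin_cases i <;> simp [act, *]
      · refine ⟨0, 1, 0, Or.inr rfl, ⟨⟨!![(θ 4)⁻¹, θ 3; 0, θ 4], ?_⟩, 0⟩, ?_⟩
        · rw [Matrix.det_fin_two_of]; field_simp; simp
        · congr 1; ext i; fin_cases i <;> simp [act, *]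
    · rw [← RR_smul θ (neg_ne_zero.2 (inv_ne_zero h2))]
      refine ⟨1, (θ 2)⁻¹ * θ 3, -(θ 2)⁻¹ * θ 4, Or.inl rfl, ⟨⟨!![0, -1; 1, 0], ?_⟩, 0⟩, ?_⟩
      · rw [Matrix.det_fin_two_of]; simp
      · congr 1; ext i; fin_cases i <;> simp [act, *]
  · rw [← RR_smul θ (inv_ne_zero h1)]
    have hd' := dd_smul θ (θ 1)⁻¹
    have e1 : ((θ 1)⁻¹ • θ) 1 = 1 := by simp [h1]
    rw [hd, mul_zero] at hd'
    generalize (θ 1)⁻¹ • θ = η at *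
    simp only [dd, e1, one_mul] at hd'
    have e2 : η 2 = -η 0 ^ 2 := by linarith
    refine ⟨1, η 0 * η 3 + η 4, η 3, Or.inl rfl, ⟨⟨!![1, 0; -η 0, 1], ?_⟩, 0⟩, ?_⟩
    · rw [Matrix.det_fin_two_of]; simp
    · congr 1; ext i; fin_cases i <;> simp [act, e1, e2] <;> ring

end ChabautyAux

open ChabautyAux in
/-- **Theorem 1.3.** A closed subgroup `H` of `G` is a Chabauty limit of
conjugates of the diagonal group `A` if and only if `H` is a conjugate of `A` or a conjugate
of `V_{(a,b,c)}` for some `a, b, c ∈ ℝ` with `a = 1` or `b = 1`. -/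
theorem chabauty_closure_of_diagonal (H : Subgroup GSL)
    (hclosed : IsClosed (H : Set GSL)) :
    (∃ u : ℕ → GSL, ChabautyTendsto (fun n => conjSet (u n) Aset) (H : Set GSL)) ↔
      ((∃ y : GSL, (H : Set GSL) = conjSet y Aset) ∨
       (∃ a b c : ℝ, (a = 1 ∨ b = 1) ∧
         ∃ y : GSL, (H : Set GSL) = conjSet y (Vabc a b c))) := by
  have hA : ∀ u, conjSet u Aset = RR (act u eA) := fun u => by
    rw [Aset_eq, RR_conj (by rw [dd_eA]; norm_num)]
  have heA : eA ≠ 0 := fun h => by simpa [eA] using congrFun h 0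
  constructor
  · rintro ⟨u, hu⟩
    have hn : ∀ n, ‖act (u n) eA‖ ≠ 0 := fun n => norm_ne_zero_iff.2 (act_ne heA)
    set Θ : ℕ → Fin 5 → ℝ := fun n => ‖act (u n) eA‖⁻¹ • act (u n) eA with hΘ
    have hmem : ∀ n, Θ n ∈ Metric.sphere (0 : Fin 5 → ℝ) 1 := fun n => by
      simp only [hΘ, mem_sphere_zero_iff_norm, norm_smul, norm_inv, norm_norm]
      exact inv_mul_cancel₀ (hn n)
    have hΘd : ∀ n, 0 ≤ dd (Θ n) := fun n => by
      simp only [hΘ]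
      rw [dd_smul, dd_act, dd_eA]; positivity
    obtain ⟨θ, hθ, φ, hφ, hlim⟩ := (isCompact_sphere (0 : Fin 5 → ℝ) 1).tendsto_subseq hmem
    have hθ0 : θ ≠ 0 := by
      rintro rfl; simp at hθ
    have h1 := RR_tendsto hlim (fun n => hΘd (φ n)) hθ0
    have h2 := chab_sub hu hφ
    have heq : (fun n => RR ((Θ ∘ φ) n)) = fun n => conjSet (u (φ n)) Aset := by
      funext n
      rw [hA]
      exact RR_smul _ (inv_ne_zero (hn (φ n)))
    rw [heq] at h1
    rw [chab_unique h2 h1]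
    have hdθ : 0 ≤ dd θ := ge_of_tendsto' (tendsto_dd hlim) fun n => hΘd (φ n)
    rcases hdθ.eq_or_lt with h | h
    · exact Or.inr (class_zero h.symm hθ0)
    · obtain ⟨y, hy⟩ := class_pos h
      exact Or.inl ⟨y, hy.symm⟩
  · rintro (⟨y, hy⟩ | ⟨a, b, c, hab, y, hy⟩)
    · refine ⟨fun _ => y, ?_⟩
      rw [hy]
      simp only [hA]
      exact RR_tendsto tendsto_const_nhds (fun n => by rw [dd_act, dd_eA]; norm_num) (act_ne heA)
    · set Θ : ℕ → Fin 5 → ℝ := fun n => ![1 / ((n : ℝ) + 1), a, 0, c, b] with hΘ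
      have hpos : ∀ n, 0 < dd (act y (Θ n)) := fun n => by
        rw [dd_act]
        simp only [hΘ, dd, Matrix.cons_val]
        have : (0 : ℝ) < 1 / ((n : ℝ) + 1) := by positivity
        nlinarith
      have hlim : Tendsto Θ atTop (𝓝 ![0, a, 0, c, b]) := by
        rw [tendsto_pi_nhds]
        intro i
        fin_cases i <;> simp [hΘ]
        simpa using tendsto_one_div_add_atTop_nhds_zero_nat (𝕜 := ℝ)
      have hne : (![0, a, 0, c, b] : Fin 5 → ℝ) ≠ 0 := by
        intro h
        have e1 := congrFun h 1
        have e2 := congrFun h 4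
        simp at e1 e2
        rcases hab with h | h <;> simp_all
      choose u hu using fun n => class_pos (hpos n)
      refine ⟨u, ?_⟩
      rw [hy, conj_V]
      simp only [hu]
      exact RR_tendsto (((act_cont y).tendsto _).comp hlim) (fun n => (hpos n).le) (act_ne hne)
end

section
/- Let N⁺ = {((1, x; 0, 1), 0) : x ∈ ℝ} ⊂ G and V_0 = {(I,(t,0)) : t ∈ ℝ} ⊂ G. Then a closed subgroup H of G lies in the Chabauty closure of {(g,v) N⁺ (g,v)⁻¹ : (g,v) ∈ G} if and only if H is a conjugate in G of N⁺ or of V_0. -/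
open Matrix Filter Topology

/-- The unipotent subgroup `N⁺ = {((1, x; 0, 1), 0) : x ∈ ℝ}` of `G`. -/
def NplusSet : Set GSL := {p | (∃ x : ℝ, (p.g : M2) = !![1, x; 0, 1]) ∧ p.v = 0}

/-- The subgroup `V_c = {(I, (t, c t)) : t ∈ ℝ}` of `G`. -/
def Vc (c : ℝ) : Set GSL := {p | p.g = 1 ∧ ∃ t : ℝ, p.v = ![t, c * t]}

namespace ChabAux

/-- The point of `G` with parameters `(a, c, α, β)` and time `s`. -/
noncomputable def pt (p : ℝ × ℝ × ℝ × ℝ) (s : ℝ) : GSL :=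
  ⟨⟨!![1 - s * p.2.2.1 * (p.1 * p.2.1), s * p.2.2.1 * (p.1 * p.1);
      - (s * p.2.2.1 * (p.2.1 * p.2.1)), 1 + s * p.2.2.1 * (p.1 * p.2.1)], by
      rw [Matrix.det_fin_two_of]; ring⟩,
    ![s * p.2.2.2 * p.1, s * p.2.2.2 * p.2.1]⟩

/-- One-parameter group with parameters `p`. -/
def Q (p : ℝ × ℝ × ℝ × ℝ) : Set GSL := Set.range (pt p)

/-- The compact parameter space. -/
def K : Set (ℝ × ℝ × ℝ × ℝ) :=
  {p | p.1 ^ 2 + p.2.1 ^ 2 = 1 ∧ p.2.2.1 ^ 2 + p.2.2.2 ^ 2 = 1}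

/-- Recovers the time `s`. -/
noncomputable def psi (q : (ℝ × ℝ × ℝ × ℝ) × GSL) : ℝ :=
  q.1.2.2.1 * (((q.2.g : M2) 0 0 - 1) * (-(q.1.1 * q.1.2.1)) + (q.2.g : M2) 0 1 * (q.1.1 ^ 2)
    - (q.2.g : M2) 1 0 * (q.1.2.1 ^ 2) + ((q.2.g : M2) 1 1 - 1) * (q.1.1 * q.1.2.1))
  + q.1.2.2.2 * (q.2.v 0 * q.1.1 + q.2.v 1 * q.1.2.1)

lemma ext' {x y : GSL} (h00 : (x.g : M2) 0 0 = (y.g : M2) 0 0)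
    (h01 : (x.g : M2) 0 1 = (y.g : M2) 0 1) (h10 : (x.g : M2) 1 0 = (y.g : M2) 1 0)
    (h11 : (x.g : M2) 1 1 = (y.g : M2) 1 1) (h0 : x.v 0 = y.v 0) (h1 : x.v 1 = y.v 1) :
    x = y := by
  obtain ⟨g, v⟩ := x
  obtain ⟨g', v'⟩ := y
  have e1 : g = g' := by
    apply Subtype.ext
    ext i j
    fin_cases i <;> fin_cases j <;> assumption
  have e2 : v = v' := by
    ext i
    fin_cases i <;> assumption
  rw [e1, e2]

lemma cont_g : Continuous (fun x : GSL => (x.g : M2)) := by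
  have h1 : Continuous (fun x : GSL => (x.g, x.v)) := continuous_induced_dom
  have h2 : Continuous (fun g : SL2 => (g : M2)) := continuous_induced_dom
  exact h2.comp (continuous_fst.comp h1)

lemma cont_v : Continuous (fun x : GSL => x.v) := by
  have h1 : Continuous (fun x : GSL => (x.g, x.v)) := continuous_induced_dom
  exact continuous_snd.comp h1

lemma cont_ge (i j : Fin 2) : Continuous (fun x : GSL => (x.g : M2) i j) :=
  cont_g.matrix_elem i j

lemma cont_ve (i : Fin 2) : Continuous (fun x : GSL => x.v i) :=
  (continuous_apply i).comp cont_v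

lemma cont_psi : Continuous psi := by
  have h (i j : Fin 2) : Continuous (fun q : (ℝ × ℝ × ℝ × ℝ) × GSL => (q.2.g : M2) i j) :=
    (cont_ge i j).comp continuous_snd
  have h' (i : Fin 2) : Continuous (fun q : (ℝ × ℝ × ℝ × ℝ) × GSL => q.2.v i) :=
    (cont_ve i).comp continuous_snd
  have h00 := h 0 0
  have h01 := h 0 1
  have h10 := h 1 0
  have h11 := h 1 1
  have h0 := h' 0
  have h1 := h' 1
  unfold psi
  fun_prop

lemma cont_pt : Continuous (fun q : (ℝ × ℝ × ℝ × ℝ) × ℝ => pt q.1 q.2) := by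
  refine continuous_induced_rng.2 (Continuous.prodMk ?_ ?_)
  · refine continuous_induced_rng.2 ?_
    refine continuous_matrix fun i j => ?_
    fin_cases i <;> fin_cases j <;> simp [pt] <;> fun_prop
  · refine continuous_pi fun i => ?_
    fin_cases i <;> simp [pt] <;> fun_prop

lemma psi_pt {p : ℝ × ℝ × ℝ × ℝ} (hp : p ∈ K) (s : ℝ) : psi (p, pt p s) = s := by
  obtain ⟨a, c, α, β⟩ := p
  obtain ⟨h1, h2⟩ := hp
  simp only at h1 h2
  have : psi ((a, c, α, β), pt (a, c, α, β) s)
      = s * (α ^ 2 * (a ^ 2 + c ^ 2) ^ 2 + β ^ 2 * (a ^ 2 + c ^ 2)) := by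
    simp [psi, pt]; ring
  rw [this, h1]
  linear_combination s * h2

lemma t2 {u : ℕ → GSL} {x y : GSL} (hx : Tendsto u atTop (𝓝 x)) (hy : Tendsto u atTop (𝓝 y)) :
    x = y := by
  apply ext'
  · exact tendsto_nhds_unique (((cont_ge 0 0).tendsto x).comp hx) (((cont_ge 0 0).tendsto y).comp hy)
  · exact tendsto_nhds_unique (((cont_ge 0 1).tendsto x).comp hx) (((cont_ge 0 1).tendsto y).comp hy)
  · exact tendsto_nhds_unique (((cont_ge 1 0).tendsto x).comp hx) (((cont_ge 1 0).tendsto y).comp hy)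
  · exact tendsto_nhds_unique (((cont_ge 1 1).tendsto x).comp hx) (((cont_ge 1 1).tendsto y).comp hy)
  · exact tendsto_nhds_unique (((cont_ve 0).tendsto x).comp hx) (((cont_ve 0).tendsto y).comp hy)
  · exact tendsto_nhds_unique (((cont_ve 1).tendsto x).comp hx) (((cont_ve 1).tendsto y).comp hy)

lemma conv {p : ℕ → ℝ × ℝ × ℝ × ℝ} {p0 : ℝ × ℝ × ℝ × ℝ} (hp : ∀ n, p n ∈ K)
    (h : Tendsto p atTop (𝓝 p0)) : ChabautyTendsto (fun n => Q (p n)) (Q p0) := by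
  constructor
  · rintro _ ⟨s, rfl⟩
    have h0 : Tendsto (fun n => (p n, s)) atTop (𝓝 (p0, s)) := h.prodMk_nhds tendsto_const_nhds
    have h1 := (cont_pt.tendsto (p0, s)).comp h0
    exact ⟨fun n => pt (p n) s, fun n => ⟨s, rfl⟩, h1⟩
  · intro k hk x hx l hl
    have hpk : Tendsto (fun n => p (k n)) atTop (𝓝 p0) := h.comp hk.tendsto_atTop
    choose s hs using hx
    have h1 : Tendsto (fun n => psi (p (k n), x n)) atTop (𝓝 (psi (p0, l))) :=
      (cont_psi.tendsto (p0, l)).comp (hpk.prodMk_nhds hl)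
    have h2 : (fun n => psi (p (k n), x n)) = s := by
      funext n
      rw [← hs n, psi_pt (hp _)]
    rw [h2] at h1
    generalize psi (p0, l) = s0 at h1
    have h0 : Tendsto (fun n => (p (k n), s n)) atTop (𝓝 (p0, s0)) := hpk.prodMk_nhds h1
    have h3' := (cont_pt.tendsto (p0, s0)).comp h0
    have h3 : Tendsto (fun n => pt (p (k n)) (s n)) atTop (𝓝 (pt p0 s0)) := h3'
    have h4 : (fun n => pt (p (k n)) (s n)) = x := funext hs
    rw [h4] at h3
    exact ⟨_, t2 h3 hl⟩

lemma uniq {X : Type*} [TopologicalSpace X] {H : ℕ → Set X} {L L' : Set X} {k : ℕ → ℕ}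
    (hk : StrictMono k) (h : ChabautyTendsto H L) (h' : ChabautyTendsto (fun n => H (k n)) L') :
    L = L' := by
  apply Set.Subset.antisymm
  · intro x hx
    obtain ⟨u, hu, hux⟩ := h.1 x hx
    exact h'.2 id strictMono_id (fun n => u (k n)) (fun n => hu _) x (hux.comp hk.tendsto_atTop)
  · intro x hx
    obtain ⟨u, hu, hux⟩ := h'.1 x hx
    exact h.2 k hk u hu x hux

lemma compactK : IsCompact K := by
  have hc : IsClosed K := by
    apply IsClosed.inter
    · exact isClosed_eq (by fun_prop) (by fun_prop)
    · exact isClosed_eq (by fun_prop) (by fun_prop)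
  have hs : K ⊆ Set.Icc (-1) 1 ×ˢ Set.Icc (-1) 1 ×ˢ Set.Icc (-1) 1 ×ˢ Set.Icc (-1) 1 := by
    rintro ⟨a, c, α, β⟩ ⟨h1, h2⟩
    simp only at h1 h2
    refine ⟨⟨?_, ?_⟩, ⟨?_, ?_⟩, ⟨?_, ?_⟩, ⟨?_, ?_⟩⟩ <;> simp only <;> nlinarith
  exact (isCompact_Icc.prod (isCompact_Icc.prod (isCompact_Icc.prod isCompact_Icc))).of_isClosed_subset hc hs

/-- Explicit element of a conjugate of `N⁺`. -/
lemma conj_n (y n : GSL) (x : ℝ) (hn : (n.g : M2) = !![1, x; 0, 1]) (hv : n.v = 0)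
    (p : ℝ × ℝ × ℝ × ℝ) (s : ℝ)
    (h1 : x * ((y.g : M2) 0 0 * (y.g : M2) 0 0) = s * p.2.2.1 * (p.1 * p.1))
    (h2 : x * ((y.g : M2) 0 0 * (y.g : M2) 1 0) = s * p.2.2.1 * (p.1 * p.2.1))
    (h3 : x * ((y.g : M2) 1 0 * (y.g : M2) 1 0) = s * p.2.2.1 * (p.2.1 * p.2.1))
    (h4 : -(x * ((y.g : M2) 0 0 * y.v 1 - (y.g : M2) 1 0 * y.v 0) * (y.g : M2) 0 0)
      = s * p.2.2.2 * p.1)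
    (h5 : -(x * ((y.g : M2) 0 0 * y.v 1 - (y.g : M2) 1 0 * y.v 0) * (y.g : M2) 1 0)
      = s * p.2.2.2 * p.2.1) :
    y * n * y⁻¹ = pt p s := by
  have hd : (y.g : M2) 0 0 * (y.g : M2) 1 1 - (y.g : M2) 0 1 * (y.g : M2) 1 0 = 1 := by
    rw [← Matrix.det_fin_two]; exact y.g.2
  apply ext' <;>
    simp [pt, hn, hv, Matrix.SpecialLinearGroup.coe_inv, Matrix.adjugate_fin_two,
      Matrix.mul_apply, Matrix.mulVec, dotProduct, Fin.sum_univ_two, Matrix.vecHead, Matrix.vecTail]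
  · linear_combination hd - h2
  · linear_combination h1
  · linear_combination -h3
  · linear_combination hd + h2
  · linear_combination h4 - y.v 0 * hd
  · linear_combination h5 - y.v 1 * hd

lemma nplus_Q (y : GSL) : ∃ p ∈ K, conjSet y NplusSet = Q p := by
  have hd : (y.g : M2) 0 0 * (y.g : M2) 1 1 - (y.g : M2) 0 1 * (y.g : M2) 1 0 = 1 := by
    rw [← Matrix.det_fin_two]; exact y.g.2
  obtain ⟨a, ha⟩ : ∃ a, a = (y.g : M2) 0 0 := ⟨_, rfl⟩
  obtain ⟨c, hc⟩ : ∃ c, c = (y.g : M2) 1 0 := ⟨_, rfl⟩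
  obtain ⟨d, hdd⟩ : ∃ d, d = a * y.v 1 - c * y.v 0 := ⟨_, rfl⟩
  rw [← ha, ← hc] at hd
  have hpos : 0 < a ^ 2 + c ^ 2 := by
    by_contra hneg
    have h1 : a = 0 := by nlinarith [sq_nonneg a, sq_nonneg c]
    have h2 : c = 0 := by nlinarith [sq_nonneg a, sq_nonneg c]
    rw [h1, h2] at hd
    norm_num at hd
  obtain ⟨r, hr, hr2⟩ : ∃ r : ℝ, 0 < r ∧ r ^ 2 = a ^ 2 + c ^ 2 :=
    ⟨√(a ^ 2 + c ^ 2), Real.sqrt_pos.2 hpos, Real.sq_sqrt hpos.le⟩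
  have hpos2 : 0 < r ^ 2 + d ^ 2 := by positivity
  obtain ⟨q, hq, hq2⟩ : ∃ q : ℝ, 0 < q ∧ q ^ 2 = r ^ 2 + d ^ 2 :=
    ⟨√(r ^ 2 + d ^ 2), Real.sqrt_pos.2 hpos2, Real.sq_sqrt hpos2.le⟩
  have key : ∀ (n : GSL) (x : ℝ), (n.g : M2) = !![1, x; 0, 1] → n.v = 0 →
      y * n * y⁻¹ = pt (a / r, c / r, r / q, -d / q) (x * r * q) := by
    intro n x hn hv
    apply conj_n y n x hn hv <;> simp only [← ha, ← hc, ← hdd] <;> field_simp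
  refine ⟨(a / r, c / r, r / q, -d / q), ⟨?_, ?_⟩, ?_⟩
  · simp only; field_simp; linarith
  · simp only; field_simp; linarith
  · ext h
    constructor
    · rintro ⟨n, ⟨⟨x, hn⟩, hv⟩, rfl⟩
      exact ⟨x * r * q, (key n x hn hv).symm⟩
    · rintro ⟨s, rfl⟩
      refine ⟨⟨sMat (s / (r * q)), 0⟩, ⟨⟨_, rfl⟩, rfl⟩, ?_⟩
      have := key ⟨sMat (s / (r * q)), 0⟩ _ rfl rfl
      simp only at this ⊢
      rw [this]
      congr 1
      field_simp

lemma Q_nplus {p : ℝ × ℝ × ℝ × ℝ} (hp : p ∈ K) (hα : p.2.2.1 ≠ 0) :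
    ∃ y, Q p = conjSet y NplusSet := by
  obtain ⟨a, c, α, β⟩ := p
  obtain ⟨h1, h2⟩ := hp
  simp only at h1 h2 hα
  let y : GSL := ⟨⟨!![a, -c; c, a], by rw [Matrix.det_fin_two_of]; linarith⟩,
    ![β / α * c, -(β / α * a)]⟩
  have key : ∀ (n : GSL) (x : ℝ), (n.g : M2) = !![1, x; 0, 1] → n.v = 0 →
      y * n * y⁻¹ = pt (a, c, α, β) (x / α) := by
    intro n x hn hv
    apply conj_n y n x hn hv <;>
      simp [y, -mul_eq_mul_right_iff, -mul_eq_mul_left_iff] <;> field_simp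
    · linear_combination x * β * a * h1
    · linear_combination x * β * c * h1
  refine ⟨y, ?_⟩
  ext h
  constructor
  · rintro ⟨s, rfl⟩
    refine ⟨⟨sMat (s * α), 0⟩, ⟨⟨_, rfl⟩, rfl⟩, ?_⟩
    have := key ⟨sMat (s * α), 0⟩ _ rfl rfl
    simp only at this ⊢
    rw [this]
    congr 1
    field_simp
  · rintro ⟨n, ⟨⟨x, hn⟩, hv⟩, rfl⟩
    exact ⟨_, (key n x hn hv).symm⟩

lemma conj_v (y n : GSL) (t : ℝ) (hn : n.g = 1) (hv : n.v = ![t, 0 * t])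
    (p : ℝ × ℝ × ℝ × ℝ) (s : ℝ) (h0 : p.2.2.1 = 0)
    (h4 : t * (y.g : M2) 0 0 = s * p.2.2.2 * p.1)
    (h5 : t * (y.g : M2) 1 0 = s * p.2.2.2 * p.2.1) :
    y * n * y⁻¹ = pt p s := by
  have hd : (y.g : M2) 0 0 * (y.g : M2) 1 1 - (y.g : M2) 0 1 * (y.g : M2) 1 0 = 1 := by
    rw [← Matrix.det_fin_two]; exact y.g.2
  apply ext' <;>
    simp [pt, hn, hv, h0, Matrix.SpecialLinearGroup.coe_inv, Matrix.adjugate_fin_two,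
      Matrix.mul_apply, Matrix.mulVec, dotProduct, Fin.sum_univ_two, Matrix.vecHead, Matrix.vecTail]
  · linear_combination h4 - y.v 0 * hd
  · linear_combination h5 - y.v 1 * hd

lemma v_Q (y : GSL) : ∃ a c : ℝ, a ^ 2 + c ^ 2 = 1 ∧ conjSet y (Vc 0) = Q (a, c, 0, 1) := by
  have hd : (y.g : M2) 0 0 * (y.g : M2) 1 1 - (y.g : M2) 0 1 * (y.g : M2) 1 0 = 1 := by
    rw [← Matrix.det_fin_two]; exact y.g.2
  obtain ⟨a, ha⟩ : ∃ a, a = (y.g : M2) 0 0 := ⟨_, rfl⟩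
  obtain ⟨c, hc⟩ : ∃ c, c = (y.g : M2) 1 0 := ⟨_, rfl⟩
  rw [← ha, ← hc] at hd
  have hpos : 0 < a ^ 2 + c ^ 2 := by
    by_contra hneg
    have h1 : a = 0 := by nlinarith [sq_nonneg a, sq_nonneg c]
    have h2 : c = 0 := by nlinarith [sq_nonneg a, sq_nonneg c]
    rw [h1, h2] at hd
    norm_num at hd
  obtain ⟨r, hr, hr2⟩ : ∃ r : ℝ, 0 < r ∧ r ^ 2 = a ^ 2 + c ^ 2 :=
    ⟨√(a ^ 2 + c ^ 2), Real.sqrt_pos.2 hpos, Real.sq_sqrt hpos.le⟩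
  have key : ∀ (n : GSL) (t : ℝ), n.g = 1 → n.v = ![t, 0 * t] →
      y * n * y⁻¹ = pt (a / r, c / r, 0, 1) (t * r) := by
    intro n t hn hv
    apply conj_v y n t hn hv <;> simp only [← ha, ← hc] <;> field_simp
  refine ⟨a / r, c / r, ?_, ?_⟩
  · field_simp; linarith
  · ext h
    constructor
    · rintro ⟨n, ⟨hn, t, hv⟩, rfl⟩
      exact ⟨_, (key n t hn hv).symm⟩
    · rintro ⟨s, rfl⟩
      refine ⟨⟨1, ![s / r, 0 * (s / r)]⟩, ⟨rfl, _, rfl⟩, ?_⟩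
      have := key ⟨1, ![s / r, 0 * (s / r)]⟩ _ rfl rfl
      simp only at this ⊢
      rw [this]
      congr 1
      field_simp

lemma Q_v {p : ℝ × ℝ × ℝ × ℝ} (hp : p ∈ K) (hα : p.2.2.1 = 0) :
    ∃ y, Q p = conjSet y (Vc 0) := by
  obtain ⟨a, c, α, β⟩ := p
  obtain ⟨h1, h2⟩ := hp
  simp only at h1 h2 hα
  subst hα
  have hβ : β * β = 1 := by linarith
  let y : GSL := ⟨⟨!![a, -c; c, a], by rw [Matrix.det_fin_two_of]; linarith⟩, 0⟩
  have key : ∀ (n : GSL) (t : ℝ), n.g = 1 → n.v = ![t, 0 * t] →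
      y * n * y⁻¹ = pt (a, c, 0, β) (t * β) := by
    intro n t hn hv
    apply conj_v y n t hn hv <;> simp [y, -mul_eq_mul_right_iff, -mul_eq_mul_left_iff]
    · linear_combination -t * a * hβ
    · linear_combination -t * c * hβ
  refine ⟨y, ?_⟩
  ext h
  constructor
  · rintro ⟨s, rfl⟩
    refine ⟨⟨1, ![s * β, 0 * (s * β)]⟩, ⟨rfl, _, rfl⟩, ?_⟩
    have := key ⟨1, ![s * β, 0 * (s * β)]⟩ _ rfl rfl
    simp only at this ⊢
    rw [this, mul_assoc, hβ, mul_one]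
  · rintro ⟨n, ⟨hn, t, hv⟩, rfl⟩
    exact ⟨_, (key n t hn hv).symm⟩

end ChabAux

open ChabAux in
/-- **Theorem 1.5.** A closed subgroup `H` of `G` is a Chabauty limit of
conjugates of `N⁺` if and only if `H` is a conjugate of `N⁺` or of `V₀`. -/
theorem chabauty_closure_of_unipotent (H : Subgroup GSL)
    (hclosed : IsClosed (H : Set GSL)) :
    (∃ u : ℕ → GSL, ChabautyTendsto (fun n => conjSet (u n) NplusSet) (H : Set GSL)) ↔
      ((∃ y : GSL, (H : Set GSL) = conjSet y NplusSet) ∨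
       (∃ y : GSL, (H : Set GSL) = conjSet y (Vc 0))) := by
  constructor
  · rintro ⟨u, hu⟩
    choose p hpK hp using fun n => nplus_Q (u n)
    simp only [hp] at hu
    obtain ⟨p0, hp0, k, hk, hlim⟩ := compactK.tendsto_subseq hpK
    have h' : ChabautyTendsto (fun n => Q (p (k n))) (Q p0) := conv (fun n => hpK _) hlim
    have hH := uniq hk hu h'
    rw [hH]
    by_cases hα : p0.2.2.1 = 0
    · exact Or.inr (Q_v hp0 hα)
    · exact Or.inl (Q_nplus hp0 hα)
  · rintro (⟨y, hy⟩ | ⟨y, hy⟩)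
    · obtain ⟨p, hpK, hp⟩ := nplus_Q y
      refine ⟨fun _ => y, ?_⟩
      rw [hy]
      simp only [hp]
      exact conv (p := fun _ => p) (fun _ => hpK) tendsto_const_nhds
    · obtain ⟨a, c, hac, hQ⟩ := v_Q y
      let p : ℕ → ℝ × ℝ × ℝ × ℝ := fun n =>
        (a, c, Real.sin (1 / ((n : ℝ) + 1)), Real.cos (1 / ((n : ℝ) + 1)))
      have hpK : ∀ n, p n ∈ K := fun n => ⟨hac, Real.sin_sq_add_cos_sq _⟩
      have hne : ∀ n, (p n).2.2.1 ≠ 0 := by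
        intro n
        have h0 : (0 : ℝ) < 1 / ((n : ℝ) + 1) := by positivity
        have h1 : 1 / ((n : ℝ) + 1) ≤ 1 := by
          rw [div_le_one (by positivity)]
          have : (0 : ℝ) ≤ n := by positivity
          linarith
        exact (Real.sin_pos_of_pos_of_lt_pi h0 (by linarith [Real.pi_gt_three])).ne'
      choose u hu using fun n => Q_nplus (hpK n) (hne n)
      refine ⟨u, ?_⟩
      rw [hy, hQ]
      simp only [← hu]
      apply conv hpK
      have ht : Tendsto (fun n : ℕ => 1 / ((n : ℝ) + 1)) atTop (𝓝 0) :=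
        tendsto_one_div_add_atTop_nhds_zero_nat
      have hs := (Real.continuous_sin.tendsto 0).comp ht
      have hc := (Real.continuous_cos.tendsto 0).comp ht
      rw [Real.sin_zero] at hs
      rw [Real.cos_zero] at hc
      exact tendsto_const_nhds.prodMk_nhds (tendsto_const_nhds.prodMk_nhds (hs.prodMk_nhds hc))
end

section
/- Let L = {(g,0) : g ∈ SL(2,ℝ)} ⊂ G. Let v_n = (α_n, 0) ∈ ℝ² with |α_n| → ∞. Then (I,v_n) L (I,v_n)⁻¹ → N⁺⋉ℝ² in the Chabauty sense, where N⁺⋉ℝ² = {((1, x; 0, 1), v) : x ∈ ℝ, v ∈ ℝ²}. -/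
open Matrix Filter Topology

/-- Convergence in `G` is entrywise. -/
lemma gsl_tendsto_iff {u : ℕ → GSL} {h : GSL} :
    Tendsto u atTop (𝓝 h) ↔
      (∀ i j, Tendsto (fun n => ((u n).g : M2) i j) atTop (𝓝 ((h.g : M2) i j))) ∧
      (∀ i, Tendsto (fun n => (u n).v i) atTop (𝓝 (h.v i))) := by
  have i1 : Topology.IsInducing (fun p : GSL => (p.g, p.v)) := ⟨rfl⟩
  have i2 : Topology.IsInducing (fun g : SL2 => (g : M2)) := ⟨rfl⟩
  rw [i1.tendsto_nhds_iff, nhds_prod_eq, tendsto_prod_iff']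
  refine and_congr ?_ ?_
  · have := i2.tendsto_nhds_iff (f := fun n => (u n).g) (l := atTop) (y := h.g)
    refine this.trans ?_
    refine tendsto_pi_nhds.trans (forall_congr' fun i => ?_)
    exact tendsto_pi_nhds
  · exact tendsto_pi_nhds

/-- Description of the conjugated Levi subgroup. -/
lemma mem_conj_iff (a : ℝ) (p : GSL) :
    p ∈ conjSet (⟨1, ![a, 0]⟩ : GSL) LeviL ↔
      p.v 0 = a - (p.g : M2) 0 0 * a ∧ p.v 1 = - ((p.g : M2) 1 0 * a) := by
  constructor
  · rintro ⟨⟨g, v⟩, hs, rfl⟩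
    have hv : v = 0 := hs
    subst hv
    simp [Matrix.mulVec, dotProduct, Fin.sum_univ_two, sub_eq_add_neg]
  · rintro ⟨h0, h1⟩
    refine ⟨⟨p.g, 0⟩, rfl, ?_⟩
    obtain ⟨g, v⟩ := p
    simp only [GSL.mul_def, GSL.inv_def, GSL.mk.injEq]
    refine ⟨by simp, ?_⟩
    ext i
    fin_cases i
    · simp at h0
      simp [Matrix.mulVec, dotProduct, Fin.sum_univ_two, sub_eq_add_neg, h0]
    · simp at h1
      simp [Matrix.mulVec, dotProduct, Fin.sum_univ_two, h1]

/-- The approximating matrix. -/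
noncomputable def apxMat (a x c : ℝ) (ha : a ≠ 0) : SL2 :=
  ⟨!![a, x; c, (1 + x * c) / a], by
    rw [Matrix.det_fin_two_of]; field_simp; ring⟩

open Classical in
/-- The approximating sequence. -/
noncomputable def apxSeq (α x p q : ℝ) : GSL :=
  if ha : 1 - p / α ≠ 0 then
    ⟨apxMat (1 - p / α) x (-(q / α)) ha, ![α - (1 - p / α) * α, q / α * α]⟩
  else ⟨1, 0⟩

lemma div_alpha_tendsto {α : ℕ → ℝ} (hα : Tendsto (fun n => |α n|) atTop atTop)
    {u : ℕ → ℝ} {l : ℝ} (hu : Tendsto u atTop (𝓝 l)) :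
    Tendsto (fun n => u n / α n) atTop (𝓝 0) := by
  have h1 : Tendsto (fun n => (α n)⁻¹) atTop (𝓝 0) := by
    rw [tendsto_zero_iff_abs_tendsto_zero]
    refine (tendsto_inv_atTop_zero.comp hα).congr fun n => ?_
    simp [abs_inv]
  simpa [div_eq_mul_inv] using hu.mul h1

/-- If `vₙ = (αₙ, 0)` with `|αₙ| → ∞`, then `(I,vₙ) L (I,vₙ)⁻¹ → N⁺ ⋉ ℝ²`
in the Chabauty sense. -/
theorem levi_conj_tendsto_NplusR2 (α : ℕ → ℝ)
    (hα : Tendsto (fun n => |α n|) atTop atTop) :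
    ChabautyTendsto (fun n => conjSet (⟨1, ![α n, 0]⟩ : GSL) LeviL) NplusR2 := by
  have hne : ∀ᶠ n in atTop, α n ≠ 0 := by
    filter_upwards [hα.eventually_gt_atTop 0] with n hn
    exact abs_pos.mp hn
  constructor
  · rintro ⟨g, v⟩ ⟨x, hx⟩
    have hx' : (g : M2) = !![1, x; 0, 1] := hx
    refine ⟨fun n => apxSeq (α n) x (v 0) (v 1), fun n => ?_, ?_⟩
    · rw [mem_conj_iff]
      unfold apxSeq
      dsimp only
      split_ifs with ha
      · simp [apxMat]
      · simp
    · have hp := div_alpha_tendsto hα (tendsto_const_nhds (x := v 0))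
      have hq := div_alpha_tendsto hα (tendsto_const_nhds (x := v 1))
      have hA : Tendsto (fun n => 1 - v 0 / α n) atTop (𝓝 1) := by
        simpa using hp.const_sub 1
      have hD : Tendsto (fun n => (1 + x * (-(v 1 / α n))) / (1 - v 0 / α n)) atTop (𝓝 1) := by
        have := ((hq.neg.const_mul x).const_add 1).div hA one_ne_zero
        rw [neg_zero, mul_zero, add_zero, div_one] at this
        exact this
      have hA0 : ∀ᶠ n in atTop, 1 - v 0 / α n ≠ 0 := hA.eventually_ne one_ne_zero
      rw [gsl_tendsto_iff]
      constructor
      · intro i j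
        simp only [hx']
        fin_cases i <;> fin_cases j
        · refine Tendsto.congr' ?_ hA
          filter_upwards [hA0] with n h
          simp [apxSeq, h, apxMat]
        · refine Tendsto.congr' ?_ (tendsto_const_nhds (x := x))
          filter_upwards [hA0] with n h
          simp [apxSeq, h, apxMat]
        · refine Tendsto.congr' ?_ (by simpa using hq.neg)
          filter_upwards [hA0] with n h
          simp [apxSeq, h, apxMat]
        · refine Tendsto.congr' ?_ hD
          filter_upwards [hA0] with n h
          simp [apxSeq, h, apxMat]
      · intro i
        refine Tendsto.congr' ?_ (tendsto_const_nhds (x := v i))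
        filter_upwards [hA0, hne] with n h h'
        fin_cases i
        · simp [apxSeq, h]
          field_simp
          ring
        · simp [apxSeq, h]
          field_simp
  · intro k hk x hx l hl
    rw [gsl_tendsto_iff] at hl
    obtain ⟨hg, hv⟩ := hl
    have hαk : Tendsto (fun n => |α (k n)|) atTop atTop := hα.comp hk.tendsto_atTop
    have hnek : ∀ᶠ n in atTop, α (k n) ≠ 0 := hk.tendsto_atTop.eventually hne
    have hx2 := fun n => (mem_conj_iff _ _).1 (hx n)
    have e0 : (l.g : M2) 0 0 = 1 := by
      refine tendsto_nhds_unique (hg 0 0) ?_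
      have := (div_alpha_tendsto hαk (hv 0)).const_sub 1
      rw [sub_zero] at this
      refine this.congr' ?_
      filter_upwards [hnek] with n h
      rw [(hx2 n).1]
      field_simp
      ring
    have e1 : (l.g : M2) 1 0 = 0 := by
      refine tendsto_nhds_unique (hg 1 0) ?_
      have := (div_alpha_tendsto hαk (hv 1)).neg
      rw [neg_zero] at this
      refine this.congr' ?_
      filter_upwards [hnek] with n h
      rw [(hx2 n).2]
      field_simp
    have hd := l.g.2
    rw [Matrix.det_fin_two] at hd
    have e2 : (l.g : M2) 1 1 = 1 := by
      rw [e0, e1] at hd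
      linarith
    refine ⟨(l.g : M2) 0 1, ?_⟩
    ext i j
    fin_cases i <;> fin_cases j <;> simp [e0, e1, e2]
end

section
/- Let (v_n) be a sequence in ℝ² with ‖v_n‖ → ∞, and let (h_n) be a sequence in SL(2,ℝ). If the conjugates (I,v_n)(h_n,0)(I,v_n)⁻¹ converge in G to an element (g,w) with g ∈ SL(2,ℝ) and w ∈ ℝ², then g is unipotent, i.e. (g − I)² = 0. -/
open Matrix Filter Topology

/-- If `‖vₙ‖ → ∞` and `(I,vₙ)(hₙ,0)(I,vₙ)⁻¹ → (g, w)` in `G`, then `g` is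
unipotent: `(g - I)² = 0`. -/
theorem unipotent_of_limit_of_conjugates (vseq : ℕ → (Fin 2 → ℝ)) (hseq : ℕ → SL2)
    (g : SL2) (w : Fin 2 → ℝ)
    (hnorm : Tendsto (fun n => ‖vseq n‖) atTop atTop)
    (hconv : Tendsto (fun n => (⟨1, vseq n⟩ : GSL) * ⟨hseq n, 0⟩ * (⟨1, vseq n⟩ : GSL)⁻¹)
      atTop (𝓝 (⟨g, w⟩ : GSL))) :
    ((g : M2) - 1) ^ 2 = 0 := by
  have hc1 : Continuous (fun p : GSL => ((p.g : M2), p.v)) := by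
    have h1 : Continuous (fun p : GSL => (p.g, p.v)) := continuous_induced_dom
    have h2 : Continuous (fun g : SL2 => (g : M2)) := continuous_induced_dom
    exact (h2.comp (continuous_fst.comp h1)).prodMk (continuous_snd.comp h1)
  have hpair := (hc1.tendsto (⟨g, w⟩ : GSL)).comp hconv
  have hA : Tendsto (fun n => (hseq n : M2)) atTop (𝓝 (g : M2)) := by
    have := (continuous_fst.tendsto _).comp hpair
    simpa [Function.comp_def] using this
  have hB : Tendsto (fun n => (1 - (hseq n : M2)) *ᵥ vseq n) atTop (𝓝 w) := by
    have := (continuous_snd.tendsto _).comp hpair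
    simpa [Function.comp_def, Matrix.sub_mulVec, Matrix.mulVec_neg, sub_eq_add_neg,
      Matrix.add_mulVec, Matrix.neg_mulVec] using this
  have hA' : Tendsto (fun n => 1 - (hseq n : M2)) atTop (𝓝 (1 - (g : M2))) :=
    tendsto_const_nhds.sub hA
  have hadj : Continuous (fun p : M2 × (Fin 2 → ℝ) => p.1.adjugate *ᵥ p.2) :=
    (continuous_fst.matrix_adjugate).matrix_mulVec continuous_snd
  have hC : Tendsto (fun n => (1 - (hseq n : M2)).det • vseq n) atTop
      (𝓝 ((1 - (g : M2)).adjugate *ᵥ w)) := by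
    have := (hadj.tendsto (1 - (g : M2), w)).comp (hA'.prodMk_nhds hB)
    simpa only [Function.comp_def, Matrix.mulVec_mulVec, Matrix.adjugate_mul,
      Matrix.smul_mulVec, Matrix.one_mulVec] using this
  have hD : Tendsto (fun n => ‖(1 - (hseq n : M2)).det‖) atTop (𝓝 0) := by
    refine (hC.norm.div_atTop hnorm).congr' ?_
    filter_upwards [hnorm.eventually_gt_atTop 0] with n hn
    rw [norm_smul, mul_div_cancel_right₀ _ hn.ne']
  have hE : Tendsto (fun n => ‖(1 - (hseq n : M2)).det‖) atTop (𝓝 ‖(1 - (g : M2)).det‖) :=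
    (((continuous_id.matrix_det).tendsto (1 - (g : M2))).comp hA').norm
  have h0 : (1 - (g : M2)).det = 0 := norm_eq_zero.mp (tendsto_nhds_unique hE hD)
  have h1 : (g : M2).det = 1 := g.det_coe
  rw [Matrix.det_fin_two] at h0 h1
  simp at h0
  ext i j
  fin_cases i <;> fin_cases j <;> simp [pow_two, Matrix.mul_apply, Fin.sum_univ_two] <;> grind
end

section
/- Let A = {(diag(a,1/a), 0) : a > 0} ⊂ G. Let v_n = (α_n, β_n) ∈ ℝ² with ‖v_n‖ → ∞ and β_n/α_n → c for some c ≠ 0. If (I,v_n) A (I,v_n)⁻¹ → H in the Chabauty sense for a closed subgroup H of G, then H = {(I,(t, −c t)) : t ∈ ℝ}. -/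
open Matrix Filter Topology

lemma GSL.tendsto_iff' (u : ℕ → GSL) (h : GSL) :
    Tendsto u atTop (𝓝 h) ↔
      Tendsto (fun n => ((u n).g : M2)) atTop (𝓝 (h.g : M2)) ∧
      Tendsto (fun n => (u n).v) atTop (𝓝 h.v) := by
  have h1 : Topology.IsInducing (fun p : GSL => (p.g, p.v)) := ⟨rfl⟩
  have h2 : Topology.IsInducing (fun g : SL2 => (g : M2)) := ⟨rfl⟩
  rw [h1.tendsto_nhds_iff, Prod.tendsto_iff, h2.tendsto_nhds_iff]
  rfl

lemma conj_mem_iff (x y : ℝ) (p : GSL) :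
    p ∈ conjSet (⟨1, ![x, y]⟩ : GSL) Aset ↔
      ∃ a : ℝ, 0 < a ∧ (p.g : M2) = !![a, 0; 0, a⁻¹] ∧ p.v = ![(1 - a) * x, (1 - a⁻¹) * y] := by
  constructor
  · rintro ⟨s, ⟨⟨a, ha, hs⟩, hv⟩, rfl⟩
    refine ⟨a, ha, ?_, ?_⟩
    · simpa using hs
    · ext i
      fin_cases i <;> simp [hs, hv, Matrix.vecHead, Matrix.vecTail] <;> ring
  · rintro ⟨a, ha, hs, hv⟩
    refine ⟨⟨p.g, 0⟩, ⟨⟨a, ha, hs⟩, rfl⟩, ?_⟩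
    obtain ⟨g, v⟩ := p
    simp only at hs hv
    subst hv
    simp only [GSL.mul_def, GSL.inv_def, GSL.mk.injEq]
    refine ⟨by simp, ?_⟩
    ext i
    fin_cases i <;> simp [hs, Matrix.mulVec, dotProduct, Fin.sum_univ_two] <;> ring

/-- If `vₙ = (αₙ, βₙ)` with `‖vₙ‖ → ∞` and `βₙ/αₙ → c ≠ 0`, and
`(I,vₙ) A (I,vₙ)⁻¹ → H` in the Chabauty sense, then `H = {(I, (t, -c t)) : t ∈ ℝ}`. -/
theorem diagonal_conj_limit_Vr (α β : ℕ → ℝ) (c : ℝ) (hc : c ≠ 0)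
    (hnorm : Tendsto (fun n => ‖(![α n, β n] : Fin 2 → ℝ)‖) atTop atTop)
    (hr : Tendsto (fun n => β n / α n) atTop (𝓝 c))
    (H : Subgroup GSL) (hclosed : IsClosed (H : Set GSL))
    (hlim : ChabautyTendsto (fun n => conjSet (⟨1, ![α n, β n]⟩ : GSL) Aset) (H : Set GSL)) :
    (H : Set GSL) = Vc (-c) := by
  have hαne : ∀ᶠ n in atTop, α n ≠ 0 := by
    filter_upwards [hr.eventually_ne hc] with n hn h0
    exact hn (by simp [h0])
  have hα : Tendsto (fun n => |α n|) atTop atTop := by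
    have hb : ∀ᶠ n in atTop, |β n / α n| < |c| + 1 :=
      hr.abs.eventually_lt_const (by linarith)
    have h1 : Tendsto (fun n => ‖(![α n, β n] : Fin 2 → ℝ)‖ / (|c| + 1)) atTop atTop :=
      hnorm.atTop_div_const (by positivity)
    refine tendsto_atTop_mono' _ ?_ h1
    filter_upwards [hαne, hb] with n h0 hn
    have hp : 0 < |α n| := abs_pos.mpr h0
    rw [abs_div, div_lt_iff₀ hp] at hn
    rw [div_le_iff₀ (by positivity), pi_norm_le_iff_of_nonneg (by positivity)]
    intro i
    have := abs_nonneg c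
    fin_cases i
    · simp; nlinarith
    · simp; nlinarith
  have hαinv : Tendsto (fun n => (α n)⁻¹) atTop (𝓝 0) := by
    rw [tendsto_zero_iff_abs_tendsto_zero]
    have := hα.inv_tendsto_atTop
    refine this.congr fun n => ?_
    simp [abs_inv]
  have key : ∀ (a : ℕ → ℝ) (t : ℝ), Tendsto a atTop (𝓝 1) →
      (∀ n, 0 < a n) →
      Tendsto (fun n => (1 - a n) * α n) atTop (𝓝 t) →
      Tendsto (fun n => (1 - (a n)⁻¹) * β n) atTop (𝓝 (-c * t)) := by
    intro a t ha hpos ht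
    have h := ((ht.mul hr).mul (ha.inv₀ one_ne_zero)).neg
    have e : -(t * c * (1:ℝ)⁻¹) = -c * t := by simp; ring
    rw [e] at h
    refine h.congr' ?_
    filter_upwards [hαne] with n h0
    have := (hpos n).ne'
    field_simp
    ring
  obtain ⟨hl1, hl2⟩ := hlim
  ext p
  constructor
  · intro hp
    obtain ⟨u, hu, hup⟩ := hl1 p hp
    rw [GSL.tendsto_iff'] at hup
    obtain ⟨hg, hv⟩ := hup
    simp only [conj_mem_iff] at hu
    choose a hapos hag hav using hu
    have hv0 : Tendsto (fun n => (1 - a n) * α n) atTop (𝓝 (p.v 0)) := by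
      refine ((tendsto_pi_nhds.mp hv) 0).congr fun n => ?_
      simp [hav]
    have hv1 : Tendsto (fun n => (1 - (a n)⁻¹) * β n) atTop (𝓝 (p.v 1)) := by
      refine ((tendsto_pi_nhds.mp hv) 1).congr fun n => ?_
      simp [hav]
    have ha1 : Tendsto a atTop (𝓝 1) := by
      have h := (hv0.mul hαinv).const_sub 1
      rw [mul_zero, sub_zero] at h
      refine h.congr' ?_
      filter_upwards [hαne] with n h0
      field_simp
      ring
    have hv1' := tendsto_nhds_unique hv1 (key a _ ha1 hapos hv0)
    have hlimg : Tendsto (fun n => ((u n).g : M2)) atTop (𝓝 (1 : M2)) := by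
      refine tendsto_pi_nhds.mpr fun i => tendsto_pi_nhds.mpr fun j => ?_
      have hi := ha1.inv₀ one_ne_zero
      simp only [hag]
      fin_cases i <;> fin_cases j <;> simp <;> first | exact ha1 | simpa using hi
    refine ⟨?_, p.v 0, ?_⟩
    · apply Subtype.ext
      exact tendsto_nhds_unique hg hlimg
    · ext i
      fin_cases i
      · simp
      · simpa using hv1'
  · rintro ⟨hg, t, hv⟩
    let a : ℕ → ℝ := fun n => if 0 < 1 - t * (α n)⁻¹ then 1 - t * (α n)⁻¹ else 1
    have hapos : ∀ n, 0 < a n := by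
      intro n
      simp only [a]
      split_ifs with h
      · exact h
      · exact one_pos
    have hb : Tendsto (fun n => 1 - t * (α n)⁻¹) atTop (𝓝 1) := by
      simpa using (hαinv.const_mul t).const_sub 1
    have hae : ∀ᶠ n in atTop, 1 - t * (α n)⁻¹ = a n := by
      filter_upwards [hb.eventually_const_lt one_pos] with n hn
      simp only [a, if_pos hn]
    have ha1 : Tendsto a atTop (𝓝 1) := hb.congr' hae
    have hv0 : Tendsto (fun n => (1 - a n) * α n) atTop (𝓝 t) := by
      refine tendsto_const_nhds.congr' ?_
      filter_upwards [hae, hαne] with n hn h0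
      rw [← hn]
      field_simp
      ring
    have hv1 := key a t ha1 hapos hv0
    refine hl2 id strictMono_id
      (fun n => ⟨aMat (a n) (hapos n).ne', ![(1 - a n) * α n, (1 - (a n)⁻¹) * β n]⟩) ?_ p ?_
    · intro n
      exact (conj_mem_iff _ _ _).mpr ⟨a n, hapos n, rfl, rfl⟩
    · rw [GSL.tendsto_iff', hg, hv]
      constructor
      · refine tendsto_pi_nhds.mpr fun i => tendsto_pi_nhds.mpr fun j => ?_
        have hi := ha1.inv₀ one_ne_zero
        fin_cases i <;> fin_cases j <;> simp [aMat] <;> first | exact ha1 | simpa using hi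
      · refine tendsto_pi_nhds.mpr fun i => ?_
        fin_cases i
        · simpa using hv0
        · simpa using hv1
end
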